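/- (Proposition 4.1) Under the stated hypotheses, let p₀ ∈ M, let γ ⊆ M be a real-analytic arc with p₀ ∈ γ, and suppose that f extends holomorphically across every point of M \ γ, i.e., for every q ∈ M \ γ there are an open neighborhood W_q of q in ℂ² and a holomorphic map F_q : W_q → ℂ² with F_q = f on W_q ∩ D. Let w' ∈ M' be a cluster value of f at p₀, i.e., there is a sequence (z_j) in D with z_j → p₀ and f(z_j) → w'. Then there exists a sequence (w_j) in M \ γ with w_j → p₀ such that F_{w_j}(w_j) → w' (the value F_q(q) at q ∈ M \ γ does not depend on the choice of the holomorphic extension F_q). -/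

import Mathlib

noncomputable section

open Complex Filter Metric Set

/-- `ℂ²`. -/
abbrev C2 := ℂ × ℂ

section Helpers
open scoped Topology ComplexConjugate

/-- complexification of a real power series -/
def cxSeries {d : ℕ} (p : FormalMultilinearSeries ℝ (Fin d → ℝ) ℝ) :
    FormalMultilinearSeries ℂ (Fin d → ℂ) ℂ := fun n =>
  ∑ I : Fin n → Fin d, ((p n (fun i => Pi.single (I i) (1:ℝ)) : ℝ) : ℂ) •
    (ContinuousMultilinearMap.mkPiAlgebraFin ℂ n ℂ).compContinuousLinearMap
      (fun i => ContinuousLinearMap.proj (R := ℂ) (φ := fun _ : Fin d => ℂ) (I i))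

theorem cxSeries_apply {d : ℕ} (p : FormalMultilinearSeries ℝ (Fin d → ℝ) ℝ) (n : ℕ)
    (x : Fin d → ℂ) : cxSeries p n (fun _ => x) =
    ∑ I : Fin n → Fin d, ((p n (fun i => Pi.single (I i) (1:ℝ)) : ℝ) : ℂ) * ∏ i, x (I i) := by
  simp [cxSeries, List.prod_ofFn]

theorem cxSeries_norm {d : ℕ} (p : FormalMultilinearSeries ℝ (Fin d → ℝ) ℝ) (n : ℕ) :
    ‖cxSeries p n‖ ≤ d ^ n * ‖p n‖ := by
  unfold cxSeries
  refine (norm_sum_le _ _).trans ?_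
  have : ∀ I ∈ (Finset.univ : Finset (Fin n → Fin d)),
      ‖((p n (fun i => Pi.single (I i) (1:ℝ)) : ℝ) : ℂ) •
    (ContinuousMultilinearMap.mkPiAlgebraFin ℂ n ℂ).compContinuousLinearMap
      (fun i => ContinuousLinearMap.proj (R := ℂ) (φ := fun _ : Fin d => ℂ) (I i))‖ ≤ ‖p n‖ := by
    intro I _
    rw [norm_smul]
    have h1 : ‖((p n (fun i => Pi.single (I i) (1:ℝ)) : ℝ) : ℂ)‖ ≤ ‖p n‖ := by
      rw [Complex.norm_real]
      refine ((p n).le_opNorm _).trans ?_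
      refine mul_le_of_le_one_right (norm_nonneg _) (Finset.prod_le_one (fun i _ => norm_nonneg _) ?_)
      intro i _
      rw [pi_norm_le_iff_of_nonneg zero_le_one]
      intro j
      by_cases h : j = I i
      · subst h; simp
      · simp [Pi.single_eq_of_ne h]
    have h2 : ‖(ContinuousMultilinearMap.mkPiAlgebraFin ℂ n ℂ).compContinuousLinearMap
      (fun i => ContinuousLinearMap.proj (R := ℂ) (φ := fun _ : Fin d => ℂ) (I i))‖ ≤ 1 := by
      refine (ContinuousMultilinearMap.norm_compContinuousLinearMap_le _ _).trans ?_
      rw [ContinuousMultilinearMap.norm_mkPiAlgebraFin, one_mul]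
      apply Finset.prod_le_one
      · intro i _; positivity
      · intro i _
        refine ContinuousLinearMap.opNorm_le_bound _ zero_le_one ?_
        intro x
        simpa using norm_le_pi_norm x (I i)
    calc _ ≤ ‖p n‖ * 1 := by gcongr
      _ = _ := mul_one _
  refine (Finset.sum_le_sum this).trans ?_
  simp

theorem cxSeries_real {d : ℕ} (p : FormalMultilinearSeries ℝ (Fin d → ℝ) ℝ) (n : ℕ)
    (x : Fin d → ℝ) : cxSeries p n (fun _ => fun k => (x k : ℂ)) = ((p n (fun _ => x) : ℝ) : ℂ) := by
  rw [cxSeries_apply]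
  have hx : (fun _ : Fin n => x) = fun _ : Fin n => ∑ j, x j • (Pi.single j (1:ℝ) : Fin d → ℝ) := by
    funext i
    exact pi_eq_sum_univ' x |>.trans (by simp)
  have := (p n).toMultilinearMap.map_sum (fun (_ : Fin n) (j : Fin d) => x j • (Pi.single j (1:ℝ) : Fin d → ℝ))
  rw [hx]
  simp only [ContinuousMultilinearMap.coe_coe] at this
  rw [this]
  push_cast
  refine Finset.sum_congr rfl fun I _ => ?_
  rw [(p n).map_smul_univ (fun i => x (I i)) (fun i => Pi.single (I i) (1:ℝ))]
  simp [mul_comm]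

theorem cx_exists {d : ℕ} (g : (Fin d → ℝ) → ℝ) (hg : AnalyticAt ℝ g 0) :
    ∃ F : (Fin d → ℂ) → ℂ, AnalyticAt ℂ F 0 ∧
      (∀ᶠ x : Fin d → ℝ in 𝓝 0, F (fun k => (x k : ℂ)) = g x) ∧
      ∀ x, F (fun k => starRingEnd ℂ (x k)) = starRingEnd ℂ (F x) := by
  obtain ⟨p, r, hp⟩ := hg
  refine ⟨(cxSeries p).sum, ?_, ?_, ?_⟩
  · have hr : 0 < (cxSeries p).radius := by
      obtain ⟨s, hs0, hs⟩ := ENNReal.lt_iff_exists_nnreal_btwn.1 (hp.r_pos.trans_le hp.r_le)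
      obtain ⟨C, hC, hb⟩ := p.norm_mul_pow_le_of_lt_radius hs
      have hs0' : 0 < s := by simpa using hs0
      refine lt_of_lt_of_le ?_ ((cxSeries p).le_radius_of_bound C (r := s / (d + 1)) ?_)
      · simp; positivity
      · intro n
        refine le_trans ?_ (hb n)
        push_cast
        rw [div_pow, mul_div_assoc', div_le_iff₀ (by positivity)]
        calc ‖cxSeries p n‖ * (s:ℝ) ^ n ≤ (d ^ n * ‖p n‖) * s ^ n := by
              gcongr; exact cxSeries_norm p n
          _ ≤ ((d + 1 : ℝ) ^ n * ‖p n‖) * s ^ n := by gcongr; linarith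
          _ = _ := by ring
    exact ((cxSeries p).hasFPowerSeriesOnBall hr).analyticAt
  · filter_upwards [Metric.eball_mem_nhds (0 : Fin d → ℝ) hp.r_pos] with x hx
    have := hp.hasSum hx
    rw [zero_add] at this
    have h2 : HasSum (fun n => ((p n (fun _ => x) : ℝ) : ℂ)) (g x : ℂ) := by
      exact_mod_cast this
    rw [FormalMultilinearSeries.sum, ← h2.tsum_eq]
    exact tsum_congr fun n => cxSeries_real p n x
  · intro x
    rw [FormalMultilinearSeries.sum, FormalMultilinearSeries.sum, Complex.conj_tsum]
    refine tsum_congr fun n => ?_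
    rw [cxSeries_apply, cxSeries_apply]
    simp [map_sum, map_prod]

/-- real coordinates on `ℂ²` -/
def realE : (Fin 4 → ℝ) →L[ℝ] ℂ × ℂ :=
  LinearMap.toContinuousLinearMap
    { toFun := fun x => (⟨x 0, x 1⟩, ⟨x 2, x 3⟩)
      map_add' := by intro x y; simp [Prod.ext_iff, Complex.ext_iff]
      map_smul' := by intro x y; simp [Prod.ext_iff, Complex.ext_iff] }

theorem realE_apply (x : Fin 4 → ℝ) : realE x = (⟨x 0, x 1⟩, ⟨x 2, x 3⟩) := rfl

/-- complexified coordinates -/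
def cxC : ((ℂ × ℂ × ℂ) × ℂ) →L[ℂ] (Fin 4 → ℂ) :=
  LinearMap.toContinuousLinearMap
    { toFun := fun X => ![(X.1.1 + X.1.2.2) / 2, -(I / 2) * (X.1.1 - X.1.2.2),
        (X.1.2.1 + X.2) / 2, -(I / 2) * (X.1.2.1 - X.2)]
      map_add' := by intro x y; ext i; fin_cases i <;> simp <;> ring
      map_smul' := by intro x y; ext i; fin_cases i <;> simp <;> ring }

theorem cxC_apply (X : (ℂ × ℂ × ℂ) × ℂ) : cxC X = ![(X.1.1 + X.1.2.2) / 2,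
    -(I / 2) * (X.1.1 - X.1.2.2), (X.1.2.1 + X.2) / 2, -(I / 2) * (X.1.2.1 - X.2)] := rfl

theorem theta_exists (r : ℂ × ℂ → ℝ) (p : ℂ × ℂ) (hr : AnalyticAt ℝ r p) (hp : r p = 0)
    (y : ℂ) (hy : fderiv ℝ r p (0, y) ≠ 0) :
    ∃ Θ : ℂ × ℂ × ℂ → ℂ, AnalyticAt ℂ Θ (p.1, p.2, conj p.1) ∧
      fderiv ℂ Θ (p.1, p.2, conj p.1) (0, 1, 0) ≠ 0 ∧
      Θ (p.1, p.2, conj p.1) = conj p.2 ∧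
      (∀ᶠ w in 𝓝 p, r w = 0 ↔ Θ (w.1, w.2, conj w.1) = conj w.2) ∧
      ∀ᶠ ζ in 𝓝 p.1, Θ (ζ, conj (Θ (p.1, p.2, conj ζ)), conj p.1) = conj p.2 := by
  set g : (Fin 4 → ℝ) → ℝ := fun x => r (p + realE x) with hgdef
  have hg : AnalyticAt ℝ g 0 := by
    have h1 : AnalyticAt ℝ (fun x => p + realE x) 0 :=
      analyticAt_const.add (realE.analyticAt 0)
    refine AnalyticAt.fun_comp ?_ h1
    simpa using hr
  obtain ⟨F, hF, hFg, hFc⟩ := cx_exists g hg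
  set u : (ℂ × ℂ × ℂ) × ℂ := ((p.1, p.2, conj p.1), conj p.2) with hu
  set R : (ℂ × ℂ × ℂ) × ℂ → ℂ := fun X => F (cxC (X - u)) with hR
  have hcont : Continuous (fun w : ℂ × ℂ =>
      (((w.1, w.2, conj w.1), conj w.2) : (ℂ × ℂ × ℂ) × ℂ)) := by fun_prop
  -- `R` restricted
  have hRr : ∀ᶠ w in 𝓝 p, R ((w.1, w.2, conj w.1), conj w.2) = r w := by
    have ht : Tendsto (fun w : ℂ × ℂ => (![(w - p).1.re, (w - p).1.im, (w - p).2.re, (w - p).2.im] : Fin 4 → ℝ))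
        (𝓝 p) (𝓝 0) := by
      have : Continuous (fun w : ℂ × ℂ => (![(w - p).1.re, (w - p).1.im, (w - p).2.re, (w - p).2.im] : Fin 4 → ℝ)) := by
        refine continuous_pi fun i => ?_
        fin_cases i <;> simp <;> fun_prop
      have h := this.tendsto p
      convert h using 2
      ext i; fin_cases i <;> simp
    filter_upwards [ht.eventually hFg] with w hw
    have e1 : cxC (((w.1, w.2, conj w.1), conj w.2) - u) = fun k =>
        (((![(w - p).1.re, (w - p).1.im, (w - p).2.re, (w - p).2.im] : Fin 4 → ℝ) k : ℝ) : ℂ) := by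
      ext k
      rw [cxC_apply]
      fin_cases k <;> simp [hu, Complex.ext_iff] <;> ring
    have e2 : p + realE ![(w - p).1.re, (w - p).1.im, (w - p).2.re, (w - p).2.im] = w := by
      rw [realE_apply]
      simp [Prod.ext_iff, Complex.ext_iff]
    rw [hR]
    simp only
    rw [e1, hw, hgdef]
    simp only
    rw [e2]
  have hRu : R u = 0 := by
    have := hRr.self_of_nhds
    rw [hp] at this
    simpa using this
  have hRa : AnalyticAt ℂ R u := by
    have h1 : AnalyticAt ℂ (fun X : (ℂ × ℂ × ℂ) × ℂ => cxC (X - u)) u := by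
      have h2 : AnalyticAt ℂ (fun X : (ℂ × ℂ × ℂ) × ℂ => X - u) u :=
        analyticAt_id.sub analyticAt_const
      exact AnalyticAt.fun_comp (cxC.analyticAt _) h2
    refine AnalyticAt.fun_comp ?_ h1
    simpa using hF
  have hRd : HasFDerivAt R (fderiv ℂ F 0 ∘L cxC) u := by
    have h1 : HasFDerivAt (fun X : (ℂ × ℂ × ℂ) × ℂ => cxC (X - u)) cxC u := by
      have := cxC.hasFDerivAt.comp u ((hasFDerivAt_id u).sub_const u)
      simpa using this
    have h3 : HasFDerivAt F (fderiv ℂ F 0) (cxC (u - u)) := by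
      simpa using hF.differentiableAt.hasFDerivAt
    exact h3.comp u h1
  have hconjR : ∀ w1 w2 s1 s2 : ℂ, R ((conj s1, conj s2, conj w1), conj w2)
      = conj (R ((w1, w2, s1), s2)) := by
    intro w1 w2 s1 s2
    rw [hR]
    simp only
    rw [← hFc]
    congr 1
    ext k
    rw [cxC_apply, cxC_apply]
    have c2 : (starRingEnd ℂ) 2 = 2 := map_ofNat _ 2
    fin_cases k <;> simp [hu, c2] <;> ring
  -- derivative of F on reals
  have hFd : ∀ x : Fin 4 → ℝ, fderiv ℂ F 0 (fun k => (x k : ℂ)) = ((fderiv ℝ r p (realE x) : ℝ) : ℂ) := by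
    intro x
    have h1 : HasDerivAt (fun t : ℝ => F (fun k => ((t * x k : ℝ) : ℂ)))
        (fderiv ℂ F 0 (fun k => (x k : ℂ))) 0 := by
      have hline : HasDerivAt (fun t : ℝ => (fun k => ((t * x k : ℝ) : ℂ))) (fun k => (x k : ℂ)) 0 := by
        rw [hasDerivAt_pi]
        intro k
        have := ((hasDerivAt_id (0:ℝ)).mul_const (x k)).ofReal_comp
        simpa using this
      have hFF : HasFDerivAt F ((fderiv ℂ F 0).restrictScalars ℝ) (fun k => (((0:ℝ) * x k : ℝ) : ℂ)) := by
        have h := hF.differentiableAt.hasFDerivAt.restrictScalars ℝ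
        have e : (fun k => (((0:ℝ) * x k : ℝ) : ℂ)) = (0 : Fin 4 → ℂ) := by ext; simp
        rw [e]; exact h
      exact hFF.comp_hasDerivAt (0:ℝ) hline
    have h2 : HasDerivAt (fun t : ℝ => ((r (p + realE (t • x)) : ℝ) : ℂ))
        ((fderiv ℝ r p (realE x) : ℝ) : ℂ) 0 := by
      refine HasDerivAt.ofReal_comp ?_
      have hline : HasDerivAt (fun t : ℝ => p + realE (t • x)) (realE x) 0 := by
        have := ((hasDerivAt_id (0:ℝ)).smul_const (realE x)).const_add p
        simpa using this
      have hrr : HasFDerivAt r (fderiv ℝ r p) (p + realE ((0:ℝ) • x)) := by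
        simpa using hr.differentiableAt.hasFDerivAt
      exact hrr.comp_hasDerivAt (0:ℝ) hline
    have h3 : (fun t : ℝ => F (fun k => ((t * x k : ℝ) : ℂ))) =ᶠ[𝓝 0]
        (fun t : ℝ => ((r (p + realE (t • x)) : ℝ) : ℂ)) := by
      have ht : Tendsto (fun t : ℝ => t • x) (𝓝 0) (𝓝 0) := by
        have : Continuous (fun t : ℝ => t • x) := by fun_prop
        simpa using this.tendsto 0
      filter_upwards [ht.eventually hFg] with t ht
      simp only [hgdef] at ht
      simpa using ht
    exact h1.unique (h2.congr_of_eventuallyEq h3)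
  set α : ℝ := fderiv ℝ r p (realE ![0,0,1,0]) with hα
  set β : ℝ := fderiv ℝ r p (realE ![0,0,0,1]) with hβ
  have hαβ : α ≠ 0 ∨ β ≠ 0 := by
    by_contra hcon
    push Not at hcon
    apply hy
    have : ((0, y) : ℂ × ℂ) = y.re • realE ![0,0,1,0] + y.im • realE ![0,0,0,1] := by
      rw [realE_apply, realE_apply]
      simp [Prod.ext_iff, Complex.ext_iff]
    rw [this, map_add, map_smul, map_smul, ← hα, ← hβ, hcon.1, hcon.2]
    simp
  have e1 := hFd ![0,0,1,0]
  have e2 := hFd ![0,0,0,1]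
  rw [← hα] at e1
  rw [← hβ] at e2
  have hRs : fderiv ℂ R u (0, 1) = (α + I * β) / 2 := by
    rw [hRd.fderiv, ContinuousLinearMap.comp_apply, ← e1, ← e2]
    have : cxC (0, 1) = (1 / 2 : ℂ) • (fun k => (((![0,0,1,0] : Fin 4 → ℝ) k : ℝ) : ℂ)) +
        (I / 2) • (fun k => (((![0,0,0,1] : Fin 4 → ℝ) k : ℝ) : ℂ)) := by
      rw [cxC_apply]
      ext k; fin_cases k <;> simp
    rw [this, map_add, map_smul, map_smul]
    simp only [smul_eq_mul]; ring
  have hRw : fderiv ℂ R u ((0, 1, 0), 0) = (α - I * β) / 2 := by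
    rw [hRd.fderiv, ContinuousLinearMap.comp_apply, ← e1, ← e2]
    have : cxC ((0, 1, 0), 0) = (1 / 2 : ℂ) • (fun k => (((![0,0,1,0] : Fin 4 → ℝ) k : ℝ) : ℂ)) -
        (I / 2) • (fun k => (((![0,0,0,1] : Fin 4 → ℝ) k : ℝ) : ℂ)) := by
      rw [cxC_apply]
      ext k; fin_cases k <;> simp
    rw [this, map_sub, map_smul, map_smul]
    simp only [smul_eq_mul]; ring
  have hRs0 : fderiv ℂ R u (0, 1) ≠ 0 := by
    rw [hRs]; intro h
    have h' : (α : ℂ) + I * β = 0 := by simpa using h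
    have h1 := congrArg Complex.re h'
    have h2 := congrArg Complex.im h'
    simp at h1 h2
    rcases hαβ with h | h <;> contradiction
  have hRw0 : fderiv ℂ R u ((0, 1, 0), 0) ≠ 0 := by
    rw [hRw]; intro h
    have h' : (α : ℂ) - I * β = 0 := by simpa using h
    have h1 := congrArg Complex.re h'
    have h2 := congrArg Complex.im h'
    simp at h1 h2
    rcases hαβ with h | h <;> contradiction
  have hinv : (fderiv ℂ R u ∘L .inr ℂ (ℂ × ℂ × ℂ) ℂ).IsInvertible := by
    refine ⟨ContinuousLinearEquiv.unitsEquivAut ℂ (Units.mk0 _ hRs0), ?_⟩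
    ext
    simp
  have hcd : ContDiffAt ℂ ⊤ R u := hRa.contDiffAt
  have pn : (⊤ : WithTop ℕ∞) ≠ 0 := by simp
  set Θ := hcd.implicitFunction pn hinv with hΘ
  have hΘu : Θ u.1 = u.2 := hcd.implicitFunction_apply_self pn hinv
  have hΘ1 : ∀ᶠ x in 𝓝 u.1, R (x, Θ x) = R u := hcd.eventually_apply_implicitFunction pn hinv
  have hΘ2 : ∀ᶠ v in 𝓝 u, R v = R u ↔ Θ v.1 = v.2 :=
    hcd.eventually_apply_eq_iff_implicitFunction pn hinv
  have hΘa : AnalyticAt ℂ Θ u.1 := (hcd.contDiffAt_implicitFunction pn hinv).analyticAt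
  refine ⟨Θ, hΘa, ?_, hΘu, ?_, ?_⟩
  · intro h0
    have h1 : HasFDerivAt (fun x => R (x, Θ x))
        ((fderiv ℂ R u) ∘L ((ContinuousLinearMap.id ℂ _).prod (fderiv ℂ Θ u.1))) u.1 := by
      have hb : HasFDerivAt (fun x => (x, Θ x))
        ((ContinuousLinearMap.id ℂ _).prod (fderiv ℂ Θ u.1)) u.1 :=
        (hasFDerivAt_id u.1).prodMk hΘa.differentiableAt.hasFDerivAt
      have ha : HasFDerivAt R (fderiv ℂ R u) (u.1, Θ u.1) := by
        rw [hΘu]; exact hRa.differentiableAt.hasFDerivAt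
      exact ha.comp u.1 hb
    have h2 : HasFDerivAt (fun x => R (x, Θ x)) (0 : (ℂ × ℂ × ℂ) →L[ℂ] ℂ) u.1 :=
      (hasFDerivAt_const (R u) u.1).congr_of_eventuallyEq hΘ1
    have h3 := congrArg (fun T : (ℂ × ℂ × ℂ) →L[ℂ] ℂ => T (0, 1, 0)) (h1.unique h2)
    simp only [ContinuousLinearMap.comp_apply, ContinuousLinearMap.prod_apply,
      ContinuousLinearMap.id_apply, _root_.zero_apply] at h3
    apply hRw0
    have h0' : fderiv ℂ Θ u.1 (0, 1, 0) = 0 := h0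
    rw [h0'] at h3
    exact h3
  · have ht : Tendsto (fun w : ℂ × ℂ => (((w.1, w.2, conj w.1), conj w.2) : (ℂ × ℂ × ℂ) × ℂ)) (𝓝 p) (𝓝 u) :=
      hcont.tendsto p
    filter_upwards [ht.eventually hΘ2, hRr] with w h1 h2
    rw [hRu, h2] at h1
    simpa using h1
  · have hΘc : ContinuousAt Θ u.1 := hΘa.continuousAt
    have t1 : Tendsto (fun ζ : ℂ => ((p.1, p.2, conj ζ) : ℂ × ℂ × ℂ)) (𝓝 p.1) (𝓝 u.1) := by
      have : Continuous (fun ζ : ℂ => ((p.1, p.2, conj ζ) : ℂ × ℂ × ℂ)) := by fun_prop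
      exact this.tendsto p.1
    have t2 : Tendsto (fun ζ : ℂ => conj (Θ (p.1, p.2, conj ζ))) (𝓝 p.1) (𝓝 p.2) := by
      have h : Tendsto (fun ζ : ℂ => conj (Θ (p.1, p.2, conj ζ))) (𝓝 p.1) (𝓝 (conj (Θ u.1))) :=
        (Complex.continuous_conj.tendsto _).comp (hΘc.tendsto.comp t1)
      have h' : conj (Θ u.1) = p.2 := by rw [hΘu]; simp [hu]
      rw [h'] at h
      exact h
    have t3 : Tendsto (fun ζ : ℂ => (((ζ, conj (Θ (p.1, p.2, conj ζ)), conj p.1), conj p.2) : (ℂ × ℂ × ℂ) × ℂ))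
        (𝓝 p.1) (𝓝 u) :=
      (tendsto_id.prodMk_nhds (t2.prodMk_nhds tendsto_const_nhds)).prodMk_nhds tendsto_const_nhds
    filter_upwards [t3.eventually hΘ2, t1.eventually hΘ1] with ζ h1 h2
    refine h1.1 ?_
    rw [hRu] at h2 ⊢
    have := hconjR p.1 p.2 (conj ζ) (Θ (p.1, p.2, conj ζ))
    rw [h2] at this
    simpa using this

def jm (w : ℂ × ℂ) : ℂ × ℂ × ℂ := (w.1, w.2, conj w.1)

theorem jm_cont : Continuous jm := by unfold jm; fun_prop

theorem jm_sub (w p : ℂ × ℂ) : jm w - jm p = jm (w - p) := by simp [jm]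

theorem jm_norm (x : ℂ × ℂ) : ‖jm x‖ = ‖x‖ := by
  simp [jm, Prod.norm_def, max_comm]

/-- no local holomorphic peak functions for `S` -/
def NoPeak (S : Set (ℂ × ℂ)) : Prop := ∀ p ∈ S, ∀ P : ℂ × ℂ → ℂ,
  (∀ᶠ w in 𝓝 p, DifferentiableAt ℂ P w) → P p = 0 →
    ¬ ∀ᶠ w in 𝓝 p, w ∈ S → w ≠ p → (P w).re < 0

theorem NoPeak.quad {S : Set (ℂ × ℂ)} (hS : NoPeak S) {p : ℂ × ℂ} (hp : p ∈ S) (P : ℂ × ℂ → ℂ)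
    (hP : ∀ᶠ w in 𝓝 p, DifferentiableAt ℂ P w) (hPp : P p = 0) (E : ℂ × ℂ → ℝ)
    (hE : E =o[𝓝 p] fun w => ‖w - p‖ ^ 2) (δ : ℝ) (hδ : 0 < δ)
    (h : ∀ᶠ w in 𝓝 p, w ∈ S → (P w).re ≤ - (δ * ‖w - p‖ ^ 2) + E w) : False := by
  refine hS p hp P hP hPp ?_
  have hE' := hE.def (half_pos hδ)
  filter_upwards [h, hE'] with w h1 h2 hw hne
  have h3 : 0 < ‖w - p‖ := norm_pos_iff.2 (sub_ne_zero.2 hne)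
  have h4 : 0 < ‖w - p‖ ^ 2 := by positivity
  have h5 := le_abs_self (E w)
  rw [Real.norm_eq_abs, Real.norm_eq_abs, abs_of_pos h4] at h2
  have := h1 hw
  nlinarith

theorem quad_lower (H : ℂ × ℂ → ℝ) (hc : Continuous H) (hh : ∀ (t : ℝ) x, H (t • x) = t ^ 2 * H x)
    (hpos : ∀ x, x ≠ 0 → 0 < H x) : ∃ δ > 0, ∀ x, δ * ‖x‖ ^ 2 ≤ H x := by
  obtain ⟨x0, hx0, hmin⟩ := (isCompact_sphere (0 : ℂ × ℂ) 1).exists_isMinOn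
    ⟨((1 : ℂ), (0 : ℂ)), by simp [Prod.norm_def]⟩ hc.continuousOn
  have hx0' : ‖x0‖ = 1 := by simpa using hx0
  refine ⟨H x0, hpos x0 (by intro h; simp [h] at hx0'), fun x => ?_⟩
  by_cases hx : x = 0
  · have : H 0 = 0 := by simpa using hh 0 0
    simp [hx, this]
  · have hn : ‖x‖ ≠ 0 := by simpa using hx
    have h1 : H x0 ≤ H (‖x‖⁻¹ • x) := hmin (by simp [norm_smul, hn])
    have h2 : x = ‖x‖ • (‖x‖⁻¹ • x) := by rw [smul_smul, mul_inv_cancel₀ hn, one_smul]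
    have h3 : H x = ‖x‖ ^ 2 * H (‖x‖⁻¹ • x) := by
      conv_lhs => rw [h2]
      rw [hh]
    rw [h3]
    nlinarith [sq_nonneg ‖x‖]

theorem norm_add_conj (a b : ℂ) : ‖a + conj b‖ ^ 2 = ‖a‖ ^ 2 + ‖b‖ ^ 2 + 2 * (a * b).re := by
  rw [Complex.sq_norm, Complex.sq_norm, Complex.sq_norm]
  simp [Complex.normSq_apply]; ring

theorem first_order (G : ℂ × ℂ × ℂ → ℂ) (p : ℂ × ℂ) (hG : DifferentiableAt ℂ G (jm p)) :
    (fun w => G (jm w) - G (jm p) - fderiv ℂ G (jm p) (jm (w - p))) =o[𝓝 p] fun w => ‖w - p‖ := by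
  have h := hG.hasFDerivAt.isLittleO
  have h2 := h.comp_tendsto (jm_cont.tendsto p)
  rw [Asymptotics.isLittleO_norm_right]
  have h3 : ((fun x' => x' - jm p) ∘ jm) =O[𝓝 p] (fun w => w - p) := by
    refine Asymptotics.IsBigO.of_bound' (Eventually.of_forall fun w => ?_)
    simp only [Function.comp_def, jm_sub, jm_norm, le_refl]
  refine (h2.trans_isBigO h3).congr_left ?_
  intro w; simp only [Function.comp_def, jm_sub]

theorem sq_o {E : ℂ × ℂ → ℂ} {p : ℂ × ℂ} (h : E =o[𝓝 p] fun w => ‖w - p‖) :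
    (fun w => ‖E w‖ ^ 2) =o[𝓝 p] fun w => ‖w - p‖ ^ 2 := by
  exact (h.norm_left).pow (by norm_num)

theorem lin3 (T : (ℂ × ℂ × ℂ) →L[ℂ] ℂ) (a b c : ℂ) :
    T (a, b, c) = a * T (1, 0, 0) + b * T (0, 1, 0) + c * T (0, 0, 1) := by
  have : ((a, b, c) : ℂ × ℂ × ℂ) = a • (1, 0, 0) + b • (0, 1, 0) + c • (0, 0, 1) := by simp
  rw [this, map_add, map_add, map_smul, map_smul, map_smul]; simp

/-- sslope of the Segre curves -/
def sslope (Θ : ℂ × ℂ × ℂ → ℂ) (X : ℂ × ℂ × ℂ) : ℂ :=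
  - (fderiv ℂ Θ X (1, 0, 0) / fderiv ℂ Θ X (0, 1, 0))

theorem jet_closed {S : Set (ℂ × ℂ)} (hS : NoPeak S) {p : ℂ × ℂ} (hp : p ∈ S)
    (Θ G : ℂ × ℂ × ℂ → ℂ) (hΘ : DifferentiableAt ℂ Θ (jm p))
    (h2 : fderiv ℂ Θ (jm p) (0, 1, 0) ≠ 0)
    (hSΘ : ∀ᶠ w in 𝓝 p, w ∈ S → Θ (jm w) = conj w.2)
    (hG : DifferentiableAt ℂ G (jm p)) (hSG : ∀ᶠ w in 𝓝 p, w ∈ S → G (jm w) = 0) :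
    fderiv ℂ G (jm p) (1, sslope Θ (jm p), 0) = 0 ∧ fderiv ℂ G (jm p) (0, 0, 1) = 0 := by
  by_contra hcon
  have e1 := first_order G p hG
  have e2 := first_order Θ p hΘ
  have hG0 : G (jm p) = 0 := hSG.self_of_nhds hp
  have hΘ0 : Θ (jm p) = conj p.2 := hSΘ.self_of_nhds hp
  set E1 := fun w => G (jm w) - G (jm p) - fderiv ℂ G (jm p) (jm (w - p)) with hE1
  set E2 := fun w => Θ (jm w) - Θ (jm p) - fderiv ℂ Θ (jm p) (jm (w - p)) with hE2
  rw [lin3] at hcon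
  set a1 := fderiv ℂ G (jm p) (1, 0, 0) with ha1
  set a2 := fderiv ℂ G (jm p) (0, 1, 0) with ha2
  set C := fderiv ℂ G (jm p) (0, 0, 1) with hC
  set t1 := fderiv ℂ Θ (jm p) (1, 0, 0) with ht1
  set t2 := fderiv ℂ Θ (jm p) (0, 1, 0) with ht2
  set κ := fderiv ℂ Θ (jm p) (0, 0, 1) with hκ
  have hsl : sslope Θ (jm p) = - (t1 / t2) := rfl
  set b := sslope Θ (jm p) with hb
  set A : ℂ × ℂ → ℂ := fun x => x.1 * a1 + x.2 * a2 with hA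
  set B : ℂ × ℂ → ℂ := fun x => x.1 * conj C with hB
  set A' : ℂ × ℂ → ℂ := fun x => x.1 * t1 + x.2 * t2 with hA'
  set B' : ℂ × ℂ → ℂ := fun x => x.1 * conj κ - x.2 with hB'
  set H : ℂ × ℂ → ℝ := fun x => ‖A x‖ ^ 2 + ‖B x‖ ^ 2 + (‖A' x‖ ^ 2 + ‖B' x‖ ^ 2) with hH
  obtain ⟨δ, hδ, hHδ⟩ := quad_lower H (by rw [hH, hA, hB, hA', hB']; fun_prop) (by
    intro t x
    have q1 : A (t • x) = t * A x := by simp [hA]; ring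
    have q2 : B (t • x) = t * B x := by simp [hB]; ring
    have q3 : A' (t • x) = t * A' x := by simp [hA']; ring
    have q4 : B' (t • x) = t * B' x := by simp [hB']; ring
    simp only [hH, q1, q2, q3, q4, norm_mul, Complex.norm_real, mul_pow, Real.norm_eq_abs, sq_abs]
    ring) (by
    intro x hx
    by_contra hneg
    have n1 := sq_nonneg ‖A x‖
    have n2 := sq_nonneg ‖B x‖
    have n3 := sq_nonneg ‖A' x‖
    have n4 := sq_nonneg ‖B' x‖
    simp only [hH] at hneg
    have z1 : ‖A x‖ ^ 2 = 0 := by linarith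
    have z2 : ‖B x‖ ^ 2 = 0 := by linarith
    have z3 : ‖A' x‖ ^ 2 = 0 := by linarith
    have w1 : x.1 * a1 + x.2 * a2 = 0 := by simpa [hA] using z1
    have w2 : x.1 = 0 ∨ C = 0 := by simpa [hB] using z2
    have w3 : x.1 * t1 + x.2 * t2 = 0 := by simpa [hA'] using z3
    have w4 : x.2 = b * x.1 := by
      rw [hsl]; field_simp; linear_combination w3
    have w5 : x.1 ≠ 0 := by
      intro h0; apply hx
      rw [h0, mul_zero] at w4
      exact Prod.ext h0 w4
    have w6 := w2.resolve_left w5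
    apply hcon
    refine ⟨?_, w6⟩
    have : x.1 * (1 * a1 + b * a2 + 0 * C) = 0 := by rw [w4] at w1; linear_combination w1
    exact (mul_eq_zero.1 this).resolve_left w5)
  have k1 : ∀ x, fderiv ℂ G (jm p) (jm x) = A x + conj (B x) := by
    intro x; rw [show jm x = (x.1, x.2, conj x.1) from rfl, lin3]; simp [hA, hB, ha1, ha2, hC]
  have k2 : ∀ x, fderiv ℂ Θ (jm p) (jm x) - conj x.2 = A' x + conj (B' x) := by
    intro x; rw [show jm x = (x.1, x.2, conj x.1) from rfl, lin3]; simp [hA', hB', ht1, ht2, hκ]; ring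
  refine hS.quad hp (fun w => 2 * (A (w - p) * B (w - p) + A' (w - p) * B' (w - p))) ?_ ?_
    (fun w => ‖E1 w‖ ^ 2 + ‖E2 w‖ ^ 2) ((sq_o e1).add (sq_o e2)) δ hδ ?_
  · refine Eventually.of_forall fun w => ?_
    simp only [hA, hB, hA', hB']
    fun_prop
  · simp [hA, hB, hA', hB']
  · filter_upwards [hSΘ, hSG] with w m1 m2 hw
    have r1 : E1 w = - (A (w - p) + conj (B (w - p))) := by
      rw [← k1]; simp only [hE1, m2 hw, hG0]; ring
    have r2 : E2 w = - (A' (w - p) + conj (B' (w - p))) := by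
      rw [← k2]; simp only [hE2, m1 hw, hΘ0]; simp
    have r3 := hHδ (w - p)
    rw [r1, r2, norm_neg, norm_neg, norm_add_conj, norm_add_conj]
    simp only [hH] at r3
    have : (2 * (A (w - p) * B (w - p) + A' (w - p) * B' (w - p))).re =
      2 * (A (w - p) * B (w - p)).re + 2 * (A' (w - p) * B' (w - p)).re := by
      simp; ring
    rw [this]
    linarith

theorem taylor2 {E : Type*} [NormedAddCommGroup E] [NormedSpace ℂ E] (f : E → ℂ) (x : E)
    (hf : AnalyticAt ℂ f x) :
    (fun y => f (x + y) - f x - fderiv ℂ f x y - (1 / 2) * fderiv ℂ (fderiv ℂ f) x y y)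
      =o[𝓝 0] fun y => ‖y‖ ^ 2 := by
  obtain ⟨P, R, hP⟩ := hf
  have h := hP.hasFPowerSeriesAt.isBigO_sub_partialSum_pow 3
  have h3 : (fun y : E => ‖y‖ ^ 3) =o[𝓝 0] fun y => ‖y‖ ^ 2 := by
    have := Asymptotics.isLittleO_norm_pow_norm_pow (E' := E) (show 2 < 3 by norm_num)
    exact this
  refine (h.trans_isLittleO h3).congr_left fun y => ?_
  have q0 := hP.factorial_smul y 0
  have q1 := hP.factorial_smul y 1
  have q2 := hP.factorial_smul y 2
  simp only [iteratedFDeriv_two_apply, iteratedFDeriv_one_apply, iteratedFDeriv_zero_apply] at q0 q1 q2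
  simp [Nat.factorial] at q0 q1 q2
  simp only [FormalMultilinearSeries.partialSum, Finset.sum_range_succ, Finset.sum_range_zero]
  rw [← q0, ← q1, ← q2]
  ring


theorem jet_levi {S : Set (ℂ × ℂ)} (hS : NoPeak S) {p : ℂ × ℂ} (hp : p ∈ S)
    (Θ : ℂ × ℂ × ℂ → ℂ) (hΘ : AnalyticAt ℂ Θ (jm p))
    (h2 : fderiv ℂ Θ (jm p) (0, 1, 0) ≠ 0)
    (hSΘ : ∀ᶠ w in 𝓝 p, w ∈ S → Θ (jm w) = conj w.2) :
    fderiv ℂ (fderiv ℂ Θ) (jm p) (0, 0, 1) (1, sslope Θ (jm p), 0) = 0 := by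
  by_contra hcon
  have e2 := first_order Θ p hΘ.differentiableAt
  have e3 : (fun w => Θ (jm w) - Θ (jm p) - fderiv ℂ Θ (jm p) (jm (w - p))
      - (1 / 2) * fderiv ℂ (fderiv ℂ Θ) (jm p) (jm (w - p)) (jm (w - p)))
      =o[𝓝 p] fun w => ‖w - p‖ ^ 2 := by
    have ht : Tendsto (fun w => jm w - jm p) (𝓝 p) (𝓝 0) := by
      have : Continuous (fun w => jm w - jm p) := jm_cont.sub continuous_const
      simpa using this.tendsto p
    have := (taylor2 Θ (jm p) hΘ).comp_tendsto ht
    refine this.congr ?_ ?_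
    · intro w; simp only [Function.comp_def, jm_sub]
      rw [← jm_sub, add_sub_cancel]
    · intro w; simp only [Function.comp_def, jm_sub, jm_norm]
  have hsym : ∀ x y, fderiv ℂ (fderiv ℂ Θ) (jm p) x y = fderiv ℂ (fderiv ℂ Θ) (jm p) y x := by
    intro x y
    have h : IsSymmSndFDerivAt ℂ Θ (jm p) :=
      (hΘ.contDiffAt (n := ⊤)).isSymmSndFDerivAt (by simp)
    exact h.eq x y
  have hΘ0 : Θ (jm p) = conj p.2 := hSΘ.self_of_nhds hp
  set D2 := fderiv ℂ (fderiv ℂ Θ) (jm p) with hD2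
  set E2 := fun w => Θ (jm w) - Θ (jm p) - fderiv ℂ Θ (jm p) (jm (w - p)) with hE2
  set E3 := fun w => Θ (jm w) - Θ (jm p) - fderiv ℂ Θ (jm p) (jm (w - p))
      - (1 / 2) * D2 (jm (w - p)) (jm (w - p)) with hE3
  set t1 := fderiv ℂ Θ (jm p) (1, 0, 0) with ht1
  set t2 := fderiv ℂ Θ (jm p) (0, 1, 0) with ht2
  set κ := fderiv ℂ Θ (jm p) (0, 0, 1) with hκ
  have hsl : sslope Θ (jm p) = - (t1 / t2) := rfl
  set b := sslope Θ (jm p) with hb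
  set lam := D2 (0, 0, 1) (1, b, 0) with hlam
  set β1 := D2 (0, 0, 1) (1, 0, 0) with hβ1
  set β2 := D2 (0, 0, 1) (0, 1, 0) with hβ2
  set κ2 := D2 (0, 0, 1) (0, 0, 1) with hκ2
  have hlam' : lam = β1 + b * β2 := by rw [hlam, lin3]; simp [hβ1, hβ2]
  set A' : ℂ × ℂ → ℂ := fun x => x.1 * t1 + x.2 * t2 with hA'
  set B' : ℂ × ℂ → ℂ := fun x => x.1 * conj κ - x.2 with hB'
  set Q : ℂ × ℂ → ℂ := fun x => D2 (x.1, x.2, 0) (x.1, x.2, 0) with hQ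
  set B : ℂ × ℂ → ℂ := fun x => x.1 * β1 + x.2 * β2 with hB
  set c : ℂ := - conj lam with hc
  set N : ℝ := (‖β2‖ ^ 2 + 1) / ‖t2‖ ^ 2 with hN
  have ht2p : 0 < ‖t2‖ ^ 2 := by have := norm_pos_iff.2 h2; positivity
  have hNp : 0 < N := by positivity
  have hNt : N * ‖t2‖ ^ 2 = ‖β2‖ ^ 2 + 1 := by rw [hN]; field_simp
  set H : ℂ × ℂ → ℝ := fun x => - (c * (B x * conj x.1)).re + N * (‖A' x‖ ^ 2 + ‖B' x‖ ^ 2) with hH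
  obtain ⟨δ, hδ, hHδ⟩ := quad_lower H (by rw [hH, hA', hB', hB]; fun_prop) (by
    intro t x
    have q1 : B (t • x) = t * B x := by simp [hB]; ring
    have q3 : A' (t • x) = t * A' x := by simp [hA']; ring
    have q4 : B' (t • x) = t * B' x := by simp [hB']; ring
    have q5 : c * (t * B x * conj (t • x).1) = ((t ^ 2 : ℝ) : ℂ) * (c * (B x * conj x.1)) := by
      simp; ring
    simp only [hH, q1, q3, q4, norm_mul, Complex.norm_real, mul_pow, Real.norm_eq_abs, sq_abs]
    rw [q5, Complex.re_ofReal_mul]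
    ring) (by
    intro x hx
    set t : ℂ := x.2 - b * x.1 with ht
    have u1 : A' x = t2 * t := by
      simp only [hA', ht, hsl]; field_simp; ring
    have u2 : B x = lam * x.1 + β2 * t := by
      simp only [hB, ht, hlam']; ring
    have u3 : (c * (B x * conj x.1)).re = - (‖lam‖ ^ 2 * ‖x.1‖ ^ 2) + (c * β2 * t * conj x.1).re := by
      have : c * (B x * conj x.1) = ((- (‖lam‖ ^ 2 * ‖x.1‖ ^ 2) : ℝ) : ℂ) + c * β2 * t * conj x.1 := by
        rw [u2, hc]
        have v1 := Complex.mul_conj' lam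
        have v2 := Complex.mul_conj' x.1
        push_cast
        rw [← v1, ← v2]; ring
      rw [this, Complex.add_re, Complex.ofReal_re]
    have u4 : (c * β2 * t * conj x.1).re ≤ ‖lam‖ * ‖β2‖ * ‖t‖ * ‖x.1‖ := by
      refine (Complex.re_le_norm _).trans ?_
      simp [hc]
    have u5 : H x ≥ (‖lam‖ * ‖x.1‖) ^ 2 - ‖lam‖ * ‖β2‖ * ‖t‖ * ‖x.1‖ + (‖β2‖ ^ 2 + 1) * ‖t‖ ^ 2 := by
      simp only [hH]
      rw [u3, u1, norm_mul, mul_pow]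
      have : 0 ≤ N * ‖B' x‖ ^ 2 := by positivity
      have v3 : N * (‖t2‖ ^ 2 * ‖t‖ ^ 2 + ‖B' x‖ ^ 2) = (‖β2‖ ^ 2 + 1) * ‖t‖ ^ 2 + N * ‖B' x‖ ^ 2 := by
        rw [← hNt]; ring
      rw [v3]
      nlinarith
    have hl : 0 < ‖lam‖ := norm_pos_iff.2 hcon
    have u6 : 0 < (‖lam‖ * ‖x.1‖) ^ 2 + ‖t‖ ^ 2 := by
      by_cases h0 : x.1 = 0
      · have : t ≠ 0 := by
          intro h; apply hx
          rw [ht, h0, mul_zero, sub_zero] at h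
          exact Prod.ext h0 h
        have := norm_pos_iff.2 this
        positivity
      · have := norm_pos_iff.2 h0
        positivity
    nlinarith [sq_nonneg (‖lam‖ * ‖x.1‖ - ‖β2‖ * ‖t‖), sq_nonneg (‖β2‖ * ‖t‖), sq_nonneg ‖t‖])
  have k2 : ∀ x, fderiv ℂ Θ (jm p) (jm x) - conj x.2 = A' x + conj (B' x) := by
    intro x; rw [show jm x = (x.1, x.2, conj x.1) from rfl, lin3]; simp [hA', hB', ht1, ht2, hκ]; ring
  have k3 : ∀ x, D2 (jm x) (jm x) = Q x + 2 * conj x.1 * B x + conj x.1 ^ 2 * κ2 := by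
    intro x
    have s1 : jm x = (x.1, x.2, 0) + conj x.1 • (0, 0, 1) := by simp [jm]
    have s2 : D2 (0, 0, 1) (x.1, x.2, 0) = B x := by rw [lin3]; simp [hB, hβ1, hβ2]
    rw [s1, map_add, map_smul]
    simp only [add_apply, smul_apply, map_add, map_smul, smul_eq_mul]
    rw [hsym (x.1, x.2, 0) (0, 0, 1), s2]
    simp only [hQ, hκ2]; ring
  refine hS.quad hp (fun w => conj c * (- B' (w - p) - (1 / 2) * conj κ2 * (w - p).1 ^ 2)
    - c * (A' (w - p) + (1 / 2) * Q (w - p)) + N * (2 * (A' (w - p) * B' (w - p)))) ?_ ?_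
    (fun w => (c * E3 w).re + N * ‖E2 w‖ ^ 2) ?_ δ hδ ?_
  · refine Eventually.of_forall fun w => ?_
    simp only [hQ, hA', hB']
    fun_prop
  · have z0 : D2 ((0 : ℂ), (0 : ℂ), (0 : ℂ)) = 0 := map_zero D2
    simp [hA', hB', hQ, z0]
  · refine Asymptotics.IsLittleO.add ?_ ((sq_o e2).const_mul_left N)
    refine Asymptotics.IsBigO.trans_isLittleO ?_ (e3.const_mul_left c)
    exact Asymptotics.IsBigO.of_bound' (Eventually.of_forall fun w => Complex.abs_re_le_norm _)
  · filter_upwards [hSΘ] with w m1 hw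
    set x := w - p with hx
    have r2 : E2 w = - (A' x + conj (B' x)) := by
      rw [← k2]; simp only [hE2, m1 hw, hΘ0, hx]; simp
    have r3 : E3 w = - (A' x + conj (B' x)) - (1 / 2) * (Q x + 2 * conj x.1 * B x + conj x.1 ^ 2 * κ2) := by
      rw [← k3, ← r2]
    have r4 := hHδ x
    simp only [hH] at r4
    rw [r2, norm_neg, norm_add_conj, r3]
    have r5 : (conj c * (- B' x - (1 / 2) * conj κ2 * x.1 ^ 2)).re
        = (c * (- conj (B' x) - (1 / 2) * κ2 * conj x.1 ^ 2)).re := by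
      rw [← Complex.conj_re]
      congr 1
      have c2 : (starRingEnd ℂ) 2 = 2 := map_ofNat _ 2
      simp [c2]
    have r6 : c * (- (A' x + conj (B' x)) - (1 / 2) * (Q x + 2 * conj x.1 * B x + conj x.1 ^ 2 * κ2))
      = c * (- conj (B' x) - (1 / 2) * κ2 * conj x.1 ^ 2) - c * (A' x + (1 / 2) * Q x)
        - c * (B x * conj x.1) := by ring
    have r7 : ((N : ℂ) * (2 * (A' x * B' x))).re = N * (2 * (A' x * B' x).re) := by
      rw [Complex.re_ofReal_mul]; simp
    rw [r6]
    simp only [Complex.add_re, Complex.sub_re] at r5 r7 ⊢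
    rw [r5, r7]
    linarith

theorem class_zero (𝒞 : Set (ℂ → ℂ)) (c : ℂ) (δ : ℝ) (hδ : 0 < δ)
    (hd : ∀ g ∈ 𝒞, DifferentiableOn ℂ g (ball c δ)) (h0 : ∀ g ∈ 𝒞, g c = 0)
    (hder : ∀ g ∈ 𝒞, ∃ h ∈ 𝒞, ∀ z ∈ ball c δ, deriv g z = h z) (g : ℂ → ℂ) (hg : g ∈ 𝒞) :
    ∀ z ∈ ball c δ, g z = 0 := by
  have key : ∀ n : ℕ, ∀ g ∈ 𝒞, iteratedDeriv n g c = 0 := by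
    intro n
    induction n with
    | zero => intro g hg; simpa using h0 g hg
    | succ n ih =>
      intro g hg
      obtain ⟨h, hh, he⟩ := hder g hg
      rw [iteratedDeriv_succ']
      have : deriv g =ᶠ[𝓝 c] h := by
        filter_upwards [ball_mem_nhds c hδ] with z hz using he z hz
      rw [this.iteratedDeriv_eq n]
      exact ih h hh
  intro z hz
  rw [← Complex.taylorSeries_eq_on_ball (hd g hg) hz]
  simp [key _ g hg]

theorem sslope_analytic {Θ : ℂ × ℂ × ℂ → ℂ} {N : Set (ℂ × ℂ × ℂ)} (hΘ : AnalyticOnNhd ℂ Θ N)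
    (h2 : ∀ X ∈ N, fderiv ℂ Θ X (0, 1, 0) ≠ 0) : AnalyticOnNhd ℂ (sslope Θ) N := by
  intro X hX
  have h := hΘ.fderiv X hX
  have a : ∀ v : ℂ × ℂ × ℂ, AnalyticAt ℂ (fun X => fderiv ℂ Θ X v) X := fun v =>
    AnalyticAt.fun_comp ((ContinuousLinearMap.apply ℂ ℂ v).analyticAt _) h
  exact ((a (1, 0, 0)).fun_div (a (0, 1, 0)) (h2 X hX)).neg

/-- the ideal of functions vanishing on `S` near `p` -/
def JJ (S : Set (ℂ × ℂ)) (p : ℂ × ℂ) (N : Set (ℂ × ℂ × ℂ)) : Set (ℂ × ℂ × ℂ → ℂ) :=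
  {G | AnalyticOnNhd ℂ G N ∧ ∀ᶠ w in 𝓝 p, w ∈ S → G (jm w) = 0}

theorem JJ_closed {S : Set (ℂ × ℂ)} (hS : NoPeak S) {p : ℂ × ℂ}
    {Θ : ℂ × ℂ × ℂ → ℂ} {N : Set (ℂ × ℂ × ℂ)} (hN : N ∈ 𝓝 (jm p)) (hΘ : AnalyticOnNhd ℂ Θ N)
    (h2 : ∀ X ∈ N, fderiv ℂ Θ X (0, 1, 0) ≠ 0)
    (hSΘ : ∀ᶠ w in 𝓝 p, w ∈ S → Θ (jm w) = conj w.2) :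
    (∀ G ∈ JJ S p N, (fun X => fderiv ℂ G X (1, sslope Θ X, 0)) ∈ JJ S p N) ∧
    (∀ G ∈ JJ S p N, (fun X => fderiv ℂ G X (0, 0, 1)) ∈ JJ S p N) ∧
    (fun X => fderiv ℂ (fderiv ℂ Θ) X (0, 0, 1) (1, sslope Θ X, 0)) ∈ JJ S p N := by
  have hN' : ∀ᶠ w in 𝓝 p, jm w ∈ N := jm_cont.tendsto p hN
  have hss := sslope_analytic hΘ h2
  have appl : ∀ (T : ℂ × ℂ × ℂ → (ℂ × ℂ × ℂ) →L[ℂ] ℂ), AnalyticOnNhd ℂ T N →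
      ∀ v : ℂ × ℂ × ℂ, AnalyticOnNhd ℂ (fun X => T X v) N := fun T hT v X hX =>
    AnalyticAt.fun_comp ((ContinuousLinearMap.apply ℂ ℂ v).analyticAt _) (hT X hX)
  have appl2 : ∀ (T : ℂ × ℂ × ℂ → (ℂ × ℂ × ℂ) →L[ℂ] ℂ), AnalyticOnNhd ℂ T N →
      AnalyticOnNhd ℂ (fun X => T X (1, sslope Θ X, 0)) N := by
    intro T hT
    have : (fun X => T X (1, sslope Θ X, 0)) =
        fun X => T X (1, 0, 0) + sslope Θ X * T X (0, 1, 0) := by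
      funext X; rw [lin3]; simp
    rw [this]
    exact (appl T hT _).add (hss.mul (appl T hT _))
  refine ⟨fun G hG => ⟨appl2 _ hG.1.fderiv, ?_⟩, fun G hG => ⟨appl _ hG.1.fderiv _, ?_⟩, ?_, ?_⟩
  · filter_upwards [hN', hSΘ.eventually_nhds, hG.2.eventually_nhds] with w a1 a2 a3 hw
    exact (jet_closed hS hw Θ G (hΘ _ a1).differentiableAt (h2 _ a1) a2
      (hG.1 _ a1).differentiableAt a3).1
  · filter_upwards [hN', hSΘ.eventually_nhds, hG.2.eventually_nhds] with w a1 a2 a3 hw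
    exact (jet_closed hS hw Θ G (hΘ _ a1).differentiableAt (h2 _ a1) a2
      (hG.1 _ a1).differentiableAt a3).2
  · refine appl2 (fun X => fderiv ℂ (fderiv ℂ Θ) X (0, 0, 1)) ?_
    intro X hX
    exact AnalyticAt.fun_comp
      ((ContinuousLinearMap.apply ℂ ((ℂ × ℂ × ℂ) →L[ℂ] ℂ) (0, 0, 1)).analyticAt _)
      (hΘ.fderiv.fderiv X hX)
  · filter_upwards [hN', hSΘ.eventually_nhds] with w a1 a2 hw
    exact jet_levi hS hw Θ (hΘ _ a1) (h2 _ a1) a2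

theorem disc_exists {S : Set (ℂ × ℂ)} (hS : NoPeak S) {p : ℂ × ℂ} (hp : p ∈ S)
    (r : ℂ × ℂ → ℝ) (hr : AnalyticAt ℝ r p) (hSr : ∀ᶠ w in 𝓝 p, w ∈ S → r w = 0)
    (y : ℂ) (hy : fderiv ℝ r p (0, y) ≠ 0) (U : Set (ℂ × ℂ)) (hU : U ∈ 𝓝 p) :
    ∃ ρ > 0, ∃ q : ℂ → ℂ, DifferentiableOn ℂ q (ball p.1 ρ) ∧
      ∀ ζ ∈ ball p.1 ρ, r (ζ, q ζ) = 0 ∧ (ζ, q ζ) ∈ U := by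
  obtain ⟨Θ, hΘ, h2, hΘp, hrΘ, hsymm⟩ := theta_exists r p hr (hSr.self_of_nhds hp) y hy
  have hSΘ : ∀ᶠ w in 𝓝 p, w ∈ S → Θ (jm w) = conj w.2 := by
    filter_upwards [hSr, hrΘ] with w a b hw using b.1 (a hw)
  have hΘ' : AnalyticAt ℂ Θ (jm p) := hΘ
  have hne : ∀ᶠ X in 𝓝 (jm p), fderiv ℂ Θ X (0, 1, 0) ≠ 0 := by
    have hc : ContinuousAt (fun X => fderiv ℂ Θ X (0, 1, 0)) (jm p) :=
      (AnalyticAt.fun_comp ((ContinuousLinearMap.apply ℂ ℂ (0, 1, 0)).analyticAt _)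
        hΘ'.fderiv).continuousAt
    exact hc.eventually_ne h2
  obtain ⟨R, hR, hball⟩ := Metric.eventually_nhds_iff_ball.1 (hΘ'.eventually_analyticAt.and hne)
  set N := ball (jm p) R with hN
  have hΘN : AnalyticOnNhd ℂ Θ N := fun X hX => (hball X hX).1
  have h2N : ∀ X ∈ N, fderiv ℂ Θ X (0, 1, 0) ≠ 0 := fun X hX => (hball X hX).2
  obtain ⟨JL, Js, Jlam⟩ := JJ_closed hS (ball_mem_nhds _ hR) hΘN h2N hSΘ
  have memN : ∀ a b c : ℂ, a ∈ ball p.1 R → b ∈ ball p.2 R → c ∈ ball (conj p.1) R →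
      (a, b, c) ∈ N := by
    intro a b c ha hb hc
    rw [hN, jm, ← ball_prod_same, ← ball_prod_same]
    exact ⟨ha, hb, hc⟩
  have p1 : p.1 ∈ ball p.1 R := mem_ball_self hR
  have p2 : p.2 ∈ ball p.2 R := mem_ball_self hR
  have p3 : conj p.1 ∈ ball (conj p.1) R := mem_ball_self hR
  set s0 := conj p.1 with hs0
  set q : ℂ → ℂ := fun ζ => conj (Θ (p.1, p.2, conj ζ)) with hq
  have hconjball : ∀ ζ ∈ ball p.1 R, conj ζ ∈ ball s0 R := by
    intro ζ hζ
    rw [mem_ball, dist_eq_norm] at hζ ⊢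
    rw [hs0, ← map_sub, Complex.norm_conj]; exact hζ
  have hqp : q p.1 = p.2 := by
    simp only [hq]; rw [← hs0, hΘp]; simp
  have hqd : ∀ ζ ∈ ball p.1 R, DifferentiableAt ℂ q ζ := by
    intro ζ hζ
    have h1 : DifferentiableAt ℂ (fun η : ℂ => Θ (p.1, p.2, η)) (conj ζ) := by
      have := (hΘN _ (memN _ _ _ p1 p2 (hconjball ζ hζ))).differentiableAt
      exact this.comp (conj ζ) (f := fun η : ℂ => (p.1, p.2, η)) (by fun_prop)
    have h3 := h1.conj_conj
    rw [Complex.conj_conj] at h3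
    exact h3
  -- choose the radius
  have hqc : ContinuousAt q p.1 := (hqd _ p1).continuousAt
  have hpq : Tendsto (fun ζ => (ζ, q ζ)) (𝓝 p.1) (𝓝 p) := by
    have : Tendsto (fun ζ => (ζ, q ζ)) (𝓝 p.1) (𝓝 (p.1, q p.1)) :=
      tendsto_id.prodMk_nhds hqc
    rw [hqp] at this
    exact this
  have hqR : ∀ᶠ ζ in 𝓝 p.1, q ζ ∈ ball p.2 R := by
    have : ball p.2 R ∈ 𝓝 (q p.1) := by rw [hqp]; exact ball_mem_nhds _ hR
    exact hqc this
  have hbR : ∀ᶠ ζ in 𝓝 p.1, ζ ∈ ball p.1 R := ball_mem_nhds p.1 hR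
  have hpqU : ∀ᶠ ζ in 𝓝 p.1, (ζ, q ζ) ∈ U := hpq hU
  obtain ⟨ρ, hρ, hρball⟩ := Metric.eventually_nhds_iff_ball.1
    ((hbR.and hqR).and (hsymm.and ((hpq.eventually hrΘ).and hpqU)))
  have b1 : ∀ ζ ∈ ball p.1 ρ, ζ ∈ ball p.1 R := fun ζ hζ => (hρball ζ hζ).1.1
  have b2 : ∀ ζ ∈ ball p.1 ρ, q ζ ∈ ball p.2 R := fun ζ hζ => (hρball ζ hζ).1.2
  have b3 : ∀ ζ ∈ ball p.1 ρ, Θ (ζ, q ζ, s0) = conj p.2 := fun ζ hζ => (hρball ζ hζ).2.1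
  have hpρ : p.1 ∈ ball p.1 ρ := mem_ball_self hρ
  have hcurve : ∀ (G : ℂ × ℂ × ℂ → ℂ) (η ζ : ℂ), η ∈ ball s0 R → ζ ∈ ball p.1 ρ →
      AnalyticOnNhd ℂ G N → HasDerivAt (fun ζ => G (ζ, q ζ, η))
        (fderiv ℂ G (ζ, q ζ, η) (1, deriv q ζ, 0)) ζ := by
    intro G η ζ hη hζ hG
    have h1 := (hG _ (memN _ _ _ (b1 ζ hζ) (b2 ζ hζ) hη)).differentiableAt.hasFDerivAt
    have h3 : HasDerivAt (fun ζ => (ζ, q ζ, η)) (1, deriv q ζ, 0) ζ :=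
      (hasDerivAt_id ζ).prodMk ((hqd ζ (b1 ζ hζ)).hasDerivAt.prodMk (hasDerivAt_const ζ η))
    exact HasFDerivAt.comp_hasDerivAt (f := fun ζ => (ζ, q ζ, η)) ζ h1 h3
  have hvert : ∀ {F : Type} [NormedAddCommGroup F] [NormedSpace ℂ F] (G : ℂ × ℂ × ℂ → F) (η ζ : ℂ),
      η ∈ ball s0 R → ζ ∈ ball p.1 ρ →
      AnalyticOnNhd ℂ G N → HasDerivAt (fun η => G (ζ, q ζ, η))
        (fderiv ℂ G (ζ, q ζ, η) (0, 0, 1)) η := by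
    intro F _ _ G η ζ hη hζ hG
    have h1 := (hG _ (memN _ _ _ (b1 ζ hζ) (b2 ζ hζ) hη)).differentiableAt.hasFDerivAt
    have h3 : HasDerivAt (fun η => (ζ, q ζ, η)) (0, 0, 1) η :=
      (hasDerivAt_const η ζ).prodMk ((hasDerivAt_const η (q ζ)).prodMk (hasDerivAt_id η))
    exact HasFDerivAt.comp_hasDerivAt (f := fun η => (ζ, q ζ, η)) η h1 h3
  have hq' : ∀ ζ ∈ ball p.1 ρ, deriv q ζ = sslope Θ (ζ, q ζ, s0) := by
    intro ζ hζ
    have h1 := hcurve Θ s0 ζ p3 hζ hΘN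
    have h3 : HasDerivAt (fun ζ => Θ (ζ, q ζ, s0)) 0 ζ := by
      refine (hasDerivAt_const ζ (conj p.2)).congr_of_eventuallyEq ?_
      filter_upwards [isOpen_ball.mem_nhds hζ] with z hz using b3 z hz
    have h4 := h1.unique h3
    rw [lin3] at h4
    have h5 := h2N _ (memN _ _ _ (b1 ζ hζ) (b2 ζ hζ) p3)
    rw [sslope]
    field_simp
    linear_combination h4
  have hA : ∀ G ∈ JJ S p N, ∀ ζ ∈ ball p.1 ρ, G (ζ, q ζ, s0) = 0 := by
    intro G hG
    refine class_zero {g | ∃ G ∈ JJ S p N, g = fun ζ => G (ζ, q ζ, s0)} p.1 ρ hρ ?_ ?_ ?_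
      (fun ζ => G (ζ, q ζ, s0)) ⟨G, hG, rfl⟩
    · rintro _ ⟨G, hG, rfl⟩ ζ hζ
      exact (hcurve G s0 ζ p3 hζ hG.1).differentiableAt.differentiableWithinAt
    · rintro _ ⟨G, hG, rfl⟩
      have := hG.2.self_of_nhds hp
      simp only [hqp]; exact this
    · rintro _ ⟨G, hG, rfl⟩
      refine ⟨_, ⟨_, JL G hG, rfl⟩, fun ζ hζ => ?_⟩
      rw [(hcurve G s0 ζ p3 hζ hG.1).deriv, hq' ζ hζ]
  have hB : ∀ G ∈ JJ S p N, ∀ ζ ∈ ball p.1 ρ, ∀ η ∈ ball s0 R, G (ζ, q ζ, η) = 0 := by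
    intro G hG ζ hζ
    refine class_zero {g | ∃ G ∈ JJ S p N, g = fun η => G (ζ, q ζ, η)} s0 R hR ?_ ?_ ?_
      (fun η => G (ζ, q ζ, η)) ⟨G, hG, rfl⟩
    · rintro _ ⟨G, hG, rfl⟩ η hη
      exact (hvert G η ζ hη hζ hG.1).differentiableAt.differentiableWithinAt
    · rintro _ ⟨G, hG, rfl⟩
      exact hA G hG ζ hζ
    · rintro _ ⟨G, hG, rfl⟩
      refine ⟨_, ⟨_, Js G hG, rfl⟩, fun η hη => ?_⟩
      rw [(hvert G η ζ hη hζ hG.1).deriv]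
  have hC : ∀ ζ ∈ ball p.1 ρ, ∀ η ∈ ball s0 R, sslope Θ (ζ, q ζ, η) = deriv q ζ := by
    intro ζ hζ η hη
    rw [hq' ζ hζ]
    have hd : ∀ η ∈ ball s0 R, HasDerivAt (fun η => sslope Θ (ζ, q ζ, η)) 0 η := by
      intro η hη
      have h0 := hvert (fderiv ℂ Θ) η ζ hη hζ hΘN.fderiv
      have h1 : ∀ v : ℂ × ℂ × ℂ, HasDerivAt (fun η => fderiv ℂ Θ (ζ, q ζ, η) v)
          (fderiv ℂ (fderiv ℂ Θ) (ζ, q ζ, η) (0, 0, 1) v) η := fun v =>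
        (ContinuousLinearMap.apply ℂ ℂ v).hasFDerivAt.comp_hasDerivAt η h0
      have hX := h2N _ (memN _ _ _ (b1 ζ hζ) (b2 ζ hζ) hη)
      have h3 := ((h1 (1, 0, 0)).div (h1 (0, 1, 0)) hX).neg
      have h4 := hB _ Jlam ζ hζ η hη
      rw [lin3] at h4
      refine HasDerivAt.congr_deriv (f := fun η => sslope Θ (ζ, q ζ, η)) h3 ?_
      rw [sslope] at h4
      field_simp at h4 ⊢
      linear_combination -h4
    exact isOpen_ball.is_const_of_deriv_eq_zero (convex_ball s0 R).isPreconnected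
      (fun x hx => (hd x hx).differentiableAt.differentiableWithinAt)
      (fun x hx => (hd x hx).deriv) hη p3
  have hD : ∀ ζ ∈ ball p.1 ρ, ∀ η ∈ ball s0 R, Θ (ζ, q ζ, η) = Θ (p.1, p.2, η) := by
    intro ζ hζ η hη
    have hd : ∀ ζ ∈ ball p.1 ρ, HasDerivAt (fun ζ => Θ (ζ, q ζ, η)) 0 ζ := by
      intro ζ hζ
      have h1 := hcurve Θ η ζ hη hζ hΘN
      convert h1 using 1
      rw [← hC ζ hζ η hη, lin3, sslope]
      have hX := h2N _ (memN _ _ _ (b1 ζ hζ) (b2 ζ hζ) hη)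
      field_simp
      ring
    have h3 := isOpen_ball.is_const_of_deriv_eq_zero (convex_ball p.1 ρ).isPreconnected
      (fun x hx => (hd x hx).differentiableAt.differentiableWithinAt)
      (fun x hx => (hd x hx).deriv) hζ hpρ
    simp only [hqp] at h3
    exact h3
  refine ⟨ρ, hρ, q, fun ζ hζ => (hqd ζ (b1 ζ hζ)).differentiableWithinAt, fun ζ hζ => ⟨?_, (hρball ζ hζ).2.2.2⟩⟩
  refine (hρball ζ hζ).2.2.1.2 ?_
  have := hD ζ hζ (conj ζ) (hconjball ζ (b1 ζ hζ))
  simp only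
  rw [this]
  simp [hq]

theorem disc_final {S : Set (ℂ × ℂ)} (hS : NoPeak S) {p : ℂ × ℂ} (hp : p ∈ S)
    (r : ℂ × ℂ → ℝ) (hr : AnalyticAt ℝ r p) (hSr : ∀ᶠ w in 𝓝 p, w ∈ S → r w = 0)
    (hy : fderiv ℝ r p ≠ 0) (U : Set (ℂ × ℂ)) (hU : U ∈ 𝓝 p) :
    ∃ φ : ℂ → ℂ × ℂ, DifferentiableOn ℂ φ (ball 0 1) ∧
      (∀ ζ ∈ ball (0 : ℂ) 1, r (φ ζ) = 0 ∧ φ ζ ∈ U) ∧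
      ∃ a ∈ ball (0 : ℂ) 1, ∃ b ∈ ball (0 : ℂ) 1, φ a ≠ φ b := by
  have hresc : ∀ (c : ℂ) (ρ : ℝ), 0 < ρ → ∀ ζ ∈ ball (0 : ℂ) 1, c + ρ * ζ ∈ ball c ρ := by
    intro c ρ hρ ζ hζ
    rw [mem_ball, dist_eq_norm] at hζ ⊢
    simp only [add_sub_cancel_left, norm_mul, Complex.norm_real, Real.norm_eq_abs, abs_of_pos hρ]
    simp only [sub_zero] at hζ
    nlinarith
  have hz : (0 : ℂ) ∈ ball (0 : ℂ) 1 := by simp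
  have hh : (1 / 2 : ℂ) ∈ ball (0 : ℂ) 1 := by
    simp; norm_num
  by_cases hex : ∃ y : ℂ, fderiv ℝ r p (0, y) ≠ 0
  · obtain ⟨y, hy⟩ := hex
    obtain ⟨ρ, hρ, q, hq, hall⟩ := disc_exists hS hp r hr hSr y hy U hU
    refine ⟨fun ζ => (p.1 + ρ * ζ, q (p.1 + ρ * ζ)), ?_, fun ζ hζ => hall _ (hresc _ _ hρ ζ hζ),
      0, hz, 1 / 2, hh, ?_⟩
    · refine DifferentiableOn.prodMk (by fun_prop) ?_
      exact hq.comp (by fun_prop) (fun ζ hζ => hresc _ _ hρ ζ hζ)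
    · intro h
      have := congrArg Prod.fst h
      simp [hρ.ne'] at this
  · push Not at hex
    have hex1 : ∃ y : ℂ, fderiv ℝ r p (y, 0) ≠ 0 := by
      by_contra hcon
      push Not at hcon
      apply hy
      ext1
      · ext1; simp [hcon]
      · ext1; simp [hex]
    obtain ⟨y, hy1⟩ := hex1
    have sw : HasFDerivAt (Prod.swap : ℂ × ℂ → ℂ × ℂ)
      ((ContinuousLinearEquiv.prodComm ℝ ℂ ℂ : ℂ × ℂ →L[ℝ] ℂ × ℂ)) p.swap :=
      (ContinuousLinearEquiv.prodComm ℝ ℂ ℂ).hasFDerivAt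
    have swc : Tendsto (Prod.swap : ℂ × ℂ → ℂ × ℂ) (𝓝 p.swap) (𝓝 p) :=
      continuous_swap.tendsto p.swap
    have swc' : Tendsto (Prod.swap : ℂ × ℂ → ℂ × ℂ) (𝓝 p) (𝓝 p.swap) :=
      continuous_swap.tendsto p
    have hS' : NoPeak (Prod.swap ⁻¹' S) := by
      intro w hw P hP hPw hcon
      have ts : Tendsto (Prod.swap : ℂ × ℂ → ℂ × ℂ) (𝓝 w.swap) (𝓝 w) :=
        continuous_swap.tendsto w.swap
      refine hS w.swap hw (P ∘ Prod.swap) ?_ (by simpa using hPw) ?_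
      · filter_upwards [ts.eventually hP] with z hz
        exact hz.comp z (ContinuousLinearEquiv.prodComm ℂ ℂ ℂ).differentiableAt
      · filter_upwards [ts.eventually hcon] with z hz hzS hne
        refine hz (by simpa using hzS) ?_
        intro h; apply hne; rw [← h]; simp
    have hrs : AnalyticAt ℝ (r ∘ Prod.swap) p.swap := by
      refine AnalyticAt.comp (by simpa using hr) ?_
      exact (ContinuousLinearEquiv.prodComm ℝ ℂ ℂ : ℂ × ℂ →L[ℝ] ℂ × ℂ).analyticAt _
    have hfd : fderiv ℝ (r ∘ Prod.swap) p.swap (0, y) ≠ 0 := by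
      have h1 : HasFDerivAt r (fderiv ℝ r p) (Prod.swap p.swap) := by
        simpa using hr.differentiableAt.hasFDerivAt
      rw [(h1.comp p.swap sw).fderiv]
      exact hy1
    obtain ⟨ρ, hρ, q, hq, hall⟩ := disc_exists hS' (p := p.swap) (by simpa using hp) (r ∘ Prod.swap)
      hrs (by
        filter_upwards [swc.eventually hSr] with w hw using hw) y hfd (Prod.swap ⁻¹' U) (swc hU)
    refine ⟨fun ζ => (q (p.2 + ρ * ζ), p.2 + ρ * ζ), ?_, fun ζ hζ => hall _ (hresc _ _ hρ ζ hζ),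
      0, hz, 1 / 2, hh, ?_⟩
    · refine DifferentiableOn.prodMk ?_ (by fun_prop)
      exact hq.comp (by fun_prop) (fun ζ hζ => hresc _ _ hρ ζ hζ)
    · intro h
      have := congrArg Prod.snd h
      simp [hρ.ne'] at this

theorem arc_avoid (c : ℝ → ℂ × ℂ) (a b : ℝ) (hc : AnalyticOnNhd ℝ c (Ioo a b))
    (v : ℂ × ℂ) (hv : v ≠ 0) (O : Set (ℂ × ℂ)) (hO : IsOpen O) (hne : O.Nonempty) :
    ∃ z ∈ O, ∀ ζ : ℂ, z + ζ • v ∉ c '' Ioo a b := by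
  set π : ℂ × ℂ →L[ℂ] ℂ := v.2 • ContinuousLinearMap.fst ℂ ℂ ℂ - v.1 • ContinuousLinearMap.snd ℂ ℂ ℂ
    with hπ
  have hπa : ∀ x, π x = v.2 * x.1 - v.1 * x.2 := by intro x; simp [hπ]
  have hsurj : Function.Surjective π := by
    intro y
    by_cases h2 : v.2 = 0
    · have h1 : v.1 ≠ 0 := by
        intro h1; exact hv (Prod.ext h1 h2)
      refine ⟨(0, - (y / v.1)), ?_⟩
      rw [hπa]; field_simp; ring
    · refine ⟨(y / v.2, 0), ?_⟩
      rw [hπa]; field_simp; ring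
  have hopen : IsOpen (π '' O) := π.isOpenMap hsurj O hO
  have hcd : ContDiffOn ℝ 1 (fun t => π (c t)) (Ioo a b) := by
    have h1 : ContDiffOn ℝ 1 c (Ioo a b) := fun t ht =>
      (hc t ht).contDiffAt.contDiffWithinAt
    exact (π.restrictScalars ℝ).contDiff.comp_contDiffOn h1
  have hdense : Dense ((fun t => π (c t)) '' Ioo a b)ᶜ := by
    refine hcd.dense_compl_image_of_dimH_lt_finrank (convex_Ioo a b) subset_rfl ?_
    have h1 : dimH (Ioo a b) ≤ dimH (univ : Set ℝ) := dimH_mono (subset_univ _)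
    rw [Real.dimH_univ] at h1
    refine lt_of_le_of_lt h1 ?_
    rw [Complex.finrank_real_complex]
    norm_num
  obtain ⟨y, hy1, hy2⟩ := hdense.inter_open_nonempty _ hopen (hne.image _)
  obtain ⟨z, hz, rfl⟩ := hy1
  refine ⟨z, hz, fun ζ hmem => hy2 ?_⟩
  obtain ⟨t, ht, hte⟩ := hmem
  refine ⟨t, ht, ?_⟩
  simp only
  rw [hte, map_add, map_smul]
  have : π v = 0 := by rw [hπa]; ring
  rw [this]; simp

theorem push_out (r : ℂ × ℂ → ℝ) (p : ℂ × ℂ) (hr : AnalyticAt ℝ r p) (h : fderiv ℝ r p ≠ 0) :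
    ∃ v : ℂ × ℂ, v ≠ 0 ∧ ∃ a > 0, ∃ δ > 0, ∀ z ∈ ball p δ, ∀ t : ℝ, 0 ≤ t →
      z + (t : ℂ) • v ∈ ball p δ → r z + a * t ≤ r (z + (t : ℂ) • v) := by
  have hex : ∃ v, 0 < fderiv ℝ r p v := by
    obtain ⟨v, hv⟩ : ∃ v, fderiv ℝ r p v ≠ 0 := by
      by_contra hcon; push Not at hcon; exact h (ContinuousLinearMap.ext hcon)
    rcases lt_or_gt_of_ne hv with h1 | h1
    · exact ⟨-v, by simpa using h1⟩
    · exact ⟨v, h1⟩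
  obtain ⟨v, hv⟩ := hex
  set m := fderiv ℝ r p v with hm
  have hv0 : v ≠ 0 := by intro h0; rw [h0, map_zero] at hm; linarith
  have hvn : 0 < ‖v‖ := norm_pos_iff.2 hv0
  have hc : 0 < m / (2 * ‖v‖) := by positivity
  have hs := hr.hasStrictFDerivAt.isLittleO.def hc
  rw [nhds_prod_eq] at hs
  obtain ⟨δ, hδ, hball⟩ : ∃ δ > 0, ∀ x ∈ ball p δ, ∀ y ∈ ball p δ,
      ‖r x - r y - fderiv ℝ r p (x - y)‖ ≤ m / (2 * ‖v‖) * ‖x - y‖ := by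
    rw [← nhds_prod_eq] at hs
    obtain ⟨δ, hδ, hb⟩ := Metric.eventually_nhds_iff_ball.1 hs
    refine ⟨δ, hδ, fun x hx y hy => hb (x, y) ?_⟩
    rw [← ball_prod_same]; exact ⟨hx, hy⟩
  refine ⟨v, hv0, m / 2, by positivity, δ, hδ, fun z hz t ht hzt => ?_⟩
  have h1 := hball _ hzt z hz
  have e : z + (t : ℂ) • v - z = t • v := by
    rw [add_sub_cancel_left]; simp [Prod.ext_iff]
  rw [e, map_smul, norm_smul, ← hm, Real.norm_eq_abs, Real.norm_eq_abs, abs_of_nonneg ht] at h1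
  have h2 : m / (2 * ‖v‖) * (t * ‖v‖) = m / 2 * t := by field_simp
  rw [h2] at h1
  have h3 := (abs_le.1 h1).1
  simp only [smul_eq_mul] at h3
  linarith

theorem root_re (w : ℂ) : (1 / 2) * ‖w‖ ^ (1 / 4 : ℝ) ≤ (w ^ (((1 / 4 : ℝ)) : ℂ)).re := by
  rw [Complex.cpow_ofReal_re]
  have h1 : 1 / 2 ≤ Real.cos (w.arg * (1 / 4)) := by
    rw [← Real.cos_abs, ← Real.cos_pi_div_three]
    have := Complex.abs_arg_le_pi w
    have hpi := Real.pi_pos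
    refine Real.cos_le_cos_of_nonneg_of_le_pi (abs_nonneg _) (by linarith) ?_
    rw [abs_mul, abs_of_pos (by norm_num : (0:ℝ) < 1 / 4)]
    linarith
  have h2 : 0 ≤ ‖w‖ ^ (1 / 4 : ℝ) := by positivity
  nlinarith

/-- cluster set at `p₀` -/
def clus (D : Set (ℂ × ℂ)) (f : ℂ × ℂ → ℂ × ℂ) (p₀ : ℂ × ℂ) : Set (ℂ × ℂ) :=
  {w | ∃ z : ℕ → ℂ × ℂ, (∀ j, z j ∈ D) ∧ Tendsto z atTop (𝓝 p₀) ∧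
    Tendsto (fun j => f (z j)) atTop (𝓝 w)}

theorem compact_step (D : Set (ℂ × ℂ)) (f : ℂ × ℂ → ℂ × ℂ) (p₀ : ℂ × ℂ) (K : Set (ℂ × ℂ))
    (hK : IsCompact K) (P : ℂ × ℂ → ℂ) (hP : ∀ w ∈ K, ContinuousAt P w)
    (hneg : ∀ w ∈ K, w ∈ clus D f p₀ → (P w).re < 0) :
    ∃ κ > 0, ∃ δ > 0, ∀ z ∈ D, z ∈ ball p₀ δ → f z ∈ K → (P (f z)).re < -κ := by
  by_contra hcon
  push Not at hcon
  have h : ∀ n : ℕ, ∃ z ∈ D, z ∈ ball p₀ (1 / ((n : ℝ) + 1)) ∧ f z ∈ K ∧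
      -(1 / ((n : ℝ) + 1)) ≤ (P (f z)).re := by
    intro n
    have hp : (0 : ℝ) < 1 / ((n : ℝ) + 1) := by positivity
    exact hcon _ hp _ hp
  choose z h1 h2 h3 h4 using h
  obtain ⟨w, hw, φ, hφ, hlim⟩ := hK.tendsto_subseq h3
  have hinv : Tendsto (fun n : ℕ => 1 / ((n : ℝ) + 1)) atTop (𝓝 0) :=
    tendsto_one_div_add_atTop_nhds_zero_nat
  have hz : Tendsto z atTop (𝓝 p₀) := by
    rw [tendsto_iff_dist_tendsto_zero]
    refine squeeze_zero (fun _ => dist_nonneg) (fun n => ?_) hinv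
    exact le_of_lt (h2 n)
  have hwc : w ∈ clus D f p₀ :=
    ⟨z ∘ φ, fun j => h1 _, hz.comp hφ.tendsto_atTop, hlim⟩
  have hlt := hneg w hw hwc
  have hPl : Tendsto (fun j => (P (f (z (φ j)))).re) atTop (𝓝 (P w).re) :=
    (Complex.continuous_re.tendsto _).comp ((hP w hw).tendsto.comp hlim)
  have hge : -(0 : ℝ) ≤ (P w).re := by
    refine le_of_tendsto_of_tendsto (hinv.comp hφ.tendsto_atTop).neg hPl ?_
    exact Eventually.of_forall fun j => h4 (φ j)
  linarith

theorem noPeak_main (D : Set (ℂ × ℂ)) (f : ℂ × ℂ → ℂ × ℂ) (r : ℂ × ℂ → ℝ) (p₀ w' : ℂ × ℂ)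
    (γ : Set (ℂ × ℂ)) (ε : ℝ) (hD : IsOpen D) (hf : DifferentiableOn ℂ f D)
    (hr : AnalyticAt ℝ r p₀) (hr0 : r p₀ = 0) (hr1 : fderiv ℝ r p₀ ≠ 0)
    (hDr : ∀ᶠ z in 𝓝 p₀, z ∈ D ↔ r z < 0)
    (hγ : ∀ v : ℂ × ℂ, v ≠ 0 → ∀ O : Set (ℂ × ℂ), IsOpen O → O.Nonempty →
      ∃ z ∈ O, ∀ ζ : ℂ, z + ζ • v ∉ γ)
    (hbad : ∀ᶠ x in 𝓝 p₀, x ∈ frontier D → x ∉ γ → ∃ (W : Set (ℂ × ℂ)) (F : ℂ × ℂ → ℂ × ℂ),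
      IsOpen W ∧ x ∈ W ∧ DifferentiableOn ℂ F W ∧ (∀ z ∈ W ∩ D, F z = f z) ∧ ε ≤ dist (F x) w') :
    NoPeak (ball w' ε ∩ clus D f p₀) := by
  rintro p ⟨hpε, hpc⟩ P hP hPp hneg
  -- radius in the target
  have hnear : ∀ᶠ w in 𝓝 p, w ∈ ball w' ε := isOpen_ball.mem_nhds hpε
  obtain ⟨η0, hη0, hη0b⟩ := Metric.eventually_nhds_iff_ball.1 (hP.and (hneg.and hnear))
  set η := η0 / 2 with hη
  have hηp : 0 < η := by positivity
  have hsub : closedBall p η ⊆ ball p η0 := closedBall_subset_ball (by linarith)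
  have hPd : ∀ w ∈ closedBall p η, DifferentiableAt ℂ P w := fun w hw => (hη0b w (hsub hw)).1
  have hPw' : ∀ w ∈ closedBall p η, dist w w' < ε := fun w hw => (hη0b w (hsub hw)).2.2
  obtain ⟨κ, hκ, δ0, hδ0, hcomp⟩ := compact_step D f p₀ (sphere p η) (isCompact_sphere p η) P
    (fun w hw => (hPd w (sphere_subset_closedBall hw)).continuousAt)
    (fun w hw hwc => by
      have hw2 := hη0b w (hsub (sphere_subset_closedBall hw))
      refine hw2.2.1 ⟨hw2.2.2, hwc⟩ ?_
      intro h; rw [h] at hw; simp at hw; linarith)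
  -- upper bound for P
  obtain ⟨B, hB⟩ : ∃ B : ℝ, ∀ w ∈ closedBall p η, ‖P w‖ ≤ B :=
    (isCompact_closedBall p η).exists_bound_of_continuousOn
      (fun w hw => (hPd w hw).continuousAt.continuousWithinAt)
  have hB0 : 0 ≤ B := (norm_nonneg _).trans (hB p (mem_closedBall_self hηp.le))
  obtain ⟨v, hv, a, ha, δ1, hδ1, hpush⟩ := push_out r p₀ hr hr1
  obtain ⟨δ2, hδ2, hδ2b⟩ := Metric.eventually_nhds_iff_ball.1 (hDr.and hbad)
  set δ := min δ0 (min δ1 δ2) with hδ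
  have hδp : 0 < δ := by positivity
  have s0 : ball p₀ δ ⊆ ball p₀ δ0 := ball_subset_ball (min_le_left _ _)
  have s1 : ball p₀ δ ⊆ ball p₀ δ1 := ball_subset_ball ((min_le_right _ _).trans (min_le_left _ _))
  have s2 : ball p₀ δ ⊆ ball p₀ δ2 := ball_subset_ball ((min_le_right _ _).trans (min_le_right _ _))
  have hvn : 0 < ‖v‖ := norm_pos_iff.2 hv
  set ρ := δ / (4 * ‖v‖) with hρ
  have hρp : 0 < ρ := by positivity
  have hline : ∀ z ∈ ball p₀ (δ / 2), ∀ ζ : ℂ, ‖ζ‖ ≤ ρ → z + ζ • v ∈ ball p₀ δ := by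
    intro z hz ζ hζ
    rw [mem_ball, dist_eq_norm] at hz ⊢
    have h1 : ‖ζ • v‖ ≤ δ / 4 := by
      rw [norm_smul]
      calc ‖ζ‖ * ‖v‖ ≤ ρ * ‖v‖ := by gcongr
        _ = δ / 4 := by rw [hρ]; field_simp
    calc ‖z + ζ • v - p₀‖ = ‖(z - p₀) + ζ • v‖ := by congr 1; abel
      _ ≤ ‖z - p₀‖ + ‖ζ • v‖ := norm_add_le _ _
      _ < δ := by linarith
  set K := (B + κ) / ((1 / 2) * (ρ / 2) ^ (1 / 4 : ℝ)) with hK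
  have hρ4 : 0 < (ρ / 2) ^ (1 / 4 : ℝ) := by positivity
  have hKp : 0 < K := by positivity
  have hKe : K * ((1 / 2) * (ρ / 2) ^ (1 / 4 : ℝ)) = B + κ := by rw [hK]; field_simp
  -- choice of the base point
  obtain ⟨z, hzO, hzγ⟩ : ∃ z, (z ∈ D ∧ z ∈ ball p₀ (δ / 2) ∧ f z ∈ ball p η ∧ -(κ / 2) < (P (f z)).re ∧
      -r z / a < ρ / 2 ∧ K * (-r z / a) ^ (1 / 4 : ℝ) < κ / 2) ∧ ∀ ζ : ℂ, z + ζ • v ∉ γ := by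
    have hev1 : ∀ᶠ z in 𝓝 p₀, z ∈ ball p₀ (δ / 2) ∧ -r z / a < ρ / 2 ∧
        K * (-r z / a) ^ (1 / 4 : ℝ) < κ / 2 := by
      have c1 : ContinuousAt (fun z => -r z / a) p₀ := (hr.continuousAt.neg).div_const a
      have c2 : ContinuousAt (fun z => K * (-r z / a) ^ (1 / 4 : ℝ)) p₀ :=
        (c1.rpow_const (Or.inr (by norm_num))).const_mul K
      have e1 : -r p₀ / a < ρ / 2 := by rw [hr0]; simp; exact hρp
      have e2 : K * (-r p₀ / a) ^ (1 / 4 : ℝ) < κ / 2 := by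
        rw [hr0]; simp; exact hκ
      have e0 : ∀ᶠ z in 𝓝 p₀, z ∈ ball p₀ (δ / 2) := ball_mem_nhds _ (by positivity)
      exact e0.and ((c1.eventually_lt_const e1).and (c2.eventually_lt_const e2))
    have hev2 : ∀ᶠ w in 𝓝 p, w ∈ ball p η ∧ -(κ / 2) < (P w).re := by
      have e0 : ∀ᶠ w in 𝓝 p, w ∈ ball p η := ball_mem_nhds _ hηp
      have c1 : ContinuousAt (fun w => (P w).re) p :=
        Complex.continuous_re.continuousAt.comp (hPd p (mem_closedBall_self hηp.le)).continuousAt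
      have e1 : -(κ / 2) < (P p).re := by rw [hPp]; simp; exact hκ
      exact e0.and (c1.eventually_const_lt e1)
    obtain ⟨zz, hzD, hzp, hzf⟩ := hpc
    obtain ⟨j, hj1, hj2⟩ := ((hzp.eventually hev1.eventually_nhds).and
      (hzf.eventually hev2.eventually_nhds)).exists
    -- the good set is a neighbourhood of zz j
    have hfc : ContinuousAt f (zz j) := (hf.differentiableAt (hD.mem_nhds (hzD j))).continuousAt
    have hDe : ∀ᶠ z in 𝓝 (zz j), z ∈ D := hD.mem_nhds (hzD j)
    have hgood : ∀ᶠ z in 𝓝 (zz j), (z ∈ D ∧ z ∈ ball p₀ (δ / 2) ∧ f z ∈ ball p η ∧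
        -(κ / 2) < (P (f z)).re ∧ -r z / a < ρ / 2 ∧ K * (-r z / a) ^ (1 / 4 : ℝ) < κ / 2) := by
      filter_upwards [hDe, hj1, hfc.eventually hj2] with z b1 b2 b3
      exact ⟨b1, b2.1, b3.1, b3.2, b2.2.1, b2.2.2⟩
    obtain ⟨O, hO1, hO2, hO3⟩ := _root_.mem_nhds_iff.1 hgood
    obtain ⟨z, hz, hzl⟩ := hγ v hv O hO2 ⟨_, hO3⟩
    exact ⟨z, hO1 hz, hzl⟩
  obtain ⟨hzD, hzδ, hzf, hzP, hzt, hzK⟩ := hzO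
  have hδ2' : ball p₀ (δ / 2) ⊆ ball p₀ δ := ball_subset_ball (by linarith)
  have hrz : r z < 0 := (hδ2b z (s2 (hδ2' hzδ))).1.1 hzD
  set t0 : ℝ := -r z / a with ht0
  have ht0p : 0 < t0 := by rw [ht0]; exact div_pos (by linarith) ha
  set G : Set ℂ := {ζ | ‖ζ‖ < ρ ∧ z + ζ • v ∈ D ∧ f (z + ζ • v) ∈ ball p η ∧
    -κ < (P (f (z + ζ • v))).re} with hG
  have hlc : Continuous (fun ζ : ℂ => z + ζ • v) := by fun_prop
  have hclG : ∀ ζ ∈ closure G, ‖ζ‖ ≤ ρ ∧ z + ζ • v ∈ D ∧ f (z + ζ • v) ∈ closedBall p η := by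
    intro ζ hζ
    obtain ⟨u, hu, hul⟩ := mem_closure_iff_seq_limit.1 hζ
    have n1 : ‖ζ‖ ≤ ρ := le_of_tendsto hul.norm (Eventually.of_forall fun j => (hu j).1.le)
    have hxl : Tendsto (fun j => z + u j • v) atTop (𝓝 (z + ζ • v)) := (hlc.tendsto ζ).comp hul
    have hxδ := hline z hzδ ζ n1
    have n2 : z + ζ • v ∈ D := by
      by_contra hnD
      have hfr : z + ζ • v ∈ frontier D := by
        rw [hD.frontier_eq]
        exact ⟨mem_closure_of_tendsto hxl (Eventually.of_forall fun j => (hu j).2.1), hnD⟩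
      obtain ⟨W, F, hW, hxW, hF, hFf, hFε⟩ := (hδ2b _ (s2 hxδ)).2 hfr (hzγ ζ)
      have hFc : ContinuousAt F (z + ζ • v) := (hF.differentiableAt (hW.mem_nhds hxW)).continuousAt
      have hFl := hFc.tendsto.comp hxl
      have hmem : F (z + ζ • v) ∈ closedBall p η := by
        refine isClosed_closedBall.mem_of_tendsto hFl ?_
        filter_upwards [hxl.eventually (hW.mem_nhds hxW)] with j hj
        simp only [Function.comp]
        rw [hFf _ ⟨hj, (hu j).2.1⟩]
        exact ball_subset_closedBall (hu j).2.2.1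
      have := hPw' _ hmem
      linarith
    refine ⟨n1, n2, ?_⟩
    have hfc : ContinuousAt f (z + ζ • v) := (hf.differentiableAt (hD.mem_nhds n2)).continuousAt
    refine isClosed_closedBall.mem_of_tendsto (hfc.tendsto.comp hxl) ?_
    exact Eventually.of_forall fun j => ball_subset_closedBall (hu j).2.2.1
  have hslit : ∀ ζ ∈ closure G, (t0 : ℂ) - ζ ∈ slitPlane := by
    intro ζ hζ
    obtain ⟨n1, n2, n3⟩ := hclG ζ hζ
    by_contra hns
    rw [Complex.mem_slitPlane_iff] at hns
    push Not at hns
    simp at hns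
    have hζr : ζ = (ζ.re : ℂ) := by apply Complex.ext <;> simp [hns.2]
    have hxδ := hline z hzδ ζ n1
    have h1 : r (z + ζ • v) < 0 := (hδ2b _ (s2 hxδ)).1.1 n2
    rw [hζr] at hxδ h1
    have h2 := hpush z (s1 (hδ2' hzδ)) ζ.re (by linarith [hns.1]) (s1 hxδ)
    have h3 : a * t0 = - r z := by rw [ht0]; field_simp
    have h4 : a * t0 ≤ a * ζ.re := by gcongr; exact hns.1
    linarith
  set H : ℂ → ℂ := fun ζ => Complex.exp (P (f (z + ζ • v)) - K * ((t0 : ℂ) - ζ) ^ (((1 / 4 : ℝ)) : ℂ))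
    with hH
  have hHn : ∀ ζ, ‖H ζ‖ = Real.exp ((P (f (z + ζ • v))).re -
      K * (((t0 : ℂ) - ζ) ^ (((1 / 4 : ℝ)) : ℂ)).re) := by
    intro ζ
    simp only [hH]
    rw [Complex.norm_exp, Complex.sub_re, Complex.re_ofReal_mul]
  have hHd : DiffContOnCl ℂ H G := by
    refine DifferentiableOn.diffContOnCl fun ζ hζ => ?_
    obtain ⟨n1, n2, n3⟩ := hclG ζ hζ
    have d1 : DifferentiableAt ℂ (fun ζ : ℂ => z + ζ • v) ζ := by fun_prop
    have d2 : DifferentiableAt ℂ (fun ζ : ℂ => f (z + ζ • v)) ζ :=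
      (hf.differentiableAt (hD.mem_nhds n2)).comp ζ d1
    have d3 : DifferentiableAt ℂ (fun ζ : ℂ => P (f (z + ζ • v))) ζ := (hPd _ n3).comp ζ d2
    have d4 : DifferentiableAt ℂ (fun ζ : ℂ => ((t0 : ℂ) - ζ) ^ (((1 / 4 : ℝ)) : ℂ)) ζ :=
      DifferentiableAt.cpow_const (by fun_prop) (hslit ζ hζ)
    exact ((d3.sub (d4.const_mul (K : ℂ))).cexp).differentiableWithinAt
  have hGb : Bornology.IsBounded G := by
    refine (isBounded_ball (x := (0 : ℂ)) (r := ρ)).subset fun ζ hζ => ?_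
    simpa using hζ.1
  have hfront : ∀ ζ ∈ frontier G, ‖H ζ‖ ≤ Real.exp (-κ) := by
    intro ζ hζ
    obtain ⟨n1, n2, n3⟩ := hclG ζ (frontier_subset_closure hζ)
    rw [hHn]
    apply Real.exp_le_exp.2
    have hroot := root_re ((t0 : ℂ) - ζ)
    rcases n1.lt_or_eq with hlt | heq
    · have hPle : (P (f (z + ζ • v))).re ≤ -κ := by
        by_contra hgt
        push Not at hgt
        have hnb : f (z + ζ • v) ∈ ball p η := by
          rcases (mem_closedBall.1 n3).lt_or_eq with h | h
          · exact h
          · have := hcomp _ n2 (s0 (hline z hzδ ζ n1)) h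
            linarith
        have hfc : ContinuousAt (fun ζ : ℂ => f (z + ζ • v)) ζ :=
          ContinuousAt.comp (g := f) (hf.differentiableAt (hD.mem_nhds n2)).continuousAt hlc.continuousAt
        have hPc : ContinuousAt (fun ζ : ℂ => (P (f (z + ζ • v))).re) ζ :=
          Complex.continuous_re.continuousAt.comp
            (ContinuousAt.comp (g := P) (f := fun ζ : ℂ => f (z + ζ • v)) (hPd _ n3).continuousAt hfc)
        have hnG : G ∈ 𝓝 ζ := by
          have m1 : ∀ᶠ x in 𝓝 ζ, ‖x‖ < ρ := continuous_norm.continuousAt.eventually_lt_const hlt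
          have m2 : ∀ᶠ x in 𝓝 ζ, z + x • v ∈ D := hlc.continuousAt (hD.mem_nhds n2)
          have m3 : ∀ᶠ x in 𝓝 ζ, f (z + x • v) ∈ ball p η := hfc (isOpen_ball.mem_nhds hnb)
          have m4 := hPc.eventually_const_lt hgt
          exact m1.and (m2.and (m3.and m4))
        exact hζ.2 (mem_interior_iff_mem_nhds.2 hnG)
      have hpos : 0 ≤ ‖(t0 : ℂ) - ζ‖ ^ (1 / 4 : ℝ) := by positivity
      nlinarith
    · have hPB : (P (f (z + ζ • v))).re ≤ B := (Complex.re_le_norm _).trans (hB _ n3)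
      have hnorm : ρ / 2 ≤ ‖(t0 : ℂ) - ζ‖ := by
        have h1 := norm_sub_norm_le ζ (t0 : ℂ)
        rw [Complex.norm_real, Real.norm_eq_abs, abs_of_pos ht0p, heq, norm_sub_rev] at h1
        linarith
      have h2 : (ρ / 2) ^ (1 / 4 : ℝ) ≤ ‖(t0 : ℂ) - ζ‖ ^ (1 / 4 : ℝ) :=
        Real.rpow_le_rpow (by positivity) hnorm (by norm_num)
      have h3 : K * ((1 / 2) * (ρ / 2) ^ (1 / 4 : ℝ)) ≤ K * (((t0 : ℂ) - ζ) ^ (((1 / 4 : ℝ)) : ℂ)).re := by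
        gcongr
        linarith
      linarith
  have h0G : (0 : ℂ) ∈ closure G := by
    refine subset_closure ⟨by simpa using hρp, ?_⟩
    simp only [zero_smul, add_zero]
    exact ⟨hzD, hzf, by linarith⟩
  have hfin := Complex.norm_le_of_forall_mem_frontier_norm_le hGb hHd hfront h0G
  rw [hHn] at hfin
  have hfin2 := Real.exp_le_exp.1 hfin
  simp only [zero_smul, add_zero, sub_zero] at hfin2
  have hre : (((t0 : ℂ)) ^ (((1 / 4 : ℝ)) : ℂ)).re ≤ t0 ^ (1 / 4 : ℝ) := by
    refine (Complex.re_le_norm _).trans ?_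
    rw [← Complex.ofReal_cpow ht0p.le, Complex.norm_real, Real.norm_eq_abs, abs_of_nonneg (by positivity)]
  have : K * (((t0 : ℂ)) ^ (((1 / 4 : ℝ)) : ℂ)).re ≤ K * t0 ^ (1 / 4 : ℝ) := by gcongr
  linarith

end Helpers

/-- Proposition 4.1: cluster values of `f` at `p₀ ∈ γ` are attained as limits of boundary
values of the holomorphic extensions of `f` at points of `M \\ γ`. -/
theorem stmt5
    (D D' M M' : Set C2) (f : C2 → C2)
    (Ω : Set C2) (r : C2 → ℝ) (Ω' : Set C2) (r' : C2 → ℝ)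
    -- `D`, `D'` are bounded domains in `ℂ²`
    (hD : IsOpen D) (hDconn : IsConnected D) (hDbd : Bornology.IsBounded D)
    (hD' : IsOpen D') (hD'conn : IsConnected D') (hD'bd : Bornology.IsBounded D')
    -- `f : D → D'` is proper holomorphic
    (hf : DifferentiableOn ℂ f D) (hfm : Set.MapsTo f D D')
    (hfp : ∀ K : Set C2, K ⊆ D' → IsCompact K → IsCompact (D ∩ f ⁻¹' K))
    -- `M` is a nonempty relatively open piece of `∂D`, `M'` a relatively open piece of `∂D'`
    (hMne : M.Nonempty) (hMsub : M ⊆ frontier D)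
    (hMopen : ∃ O : Set C2, IsOpen O ∧ M = frontier D ∩ O)
    (hM'sub : M' ⊆ frontier D')
    (hM'open : ∃ O : Set C2, IsOpen O ∧ M' = frontier D' ∩ O)
    -- hypothesis (i): `∂D` is smooth real-analytic of finite type near `closure M`
    (hΩ : IsOpen Ω) (hMΩ : closure M ⊆ Ω)
    (hr : AnalyticOnNhd ℝ r Ω) (hrgrad : ∀ p ∈ Ω, fderiv ℝ r p ≠ 0)
    (hrbd : frontier D ∩ Ω = {p : C2 | p ∈ Ω ∧ r p = 0})
    (hrD : D ∩ Ω = {p : C2 | p ∈ Ω ∧ r p < 0})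
    (hft : ∀ φ : ℂ → C2, DifferentiableOn ℂ φ (Metric.ball (0 : ℂ) 1) →
      (∀ ζ ∈ Metric.ball (0 : ℂ) 1, φ ζ ∈ frontier D ∩ Ω) →
      ∀ a ∈ Metric.ball (0 : ℂ) 1, ∀ b ∈ Metric.ball (0 : ℂ) 1, φ a = φ b)
    -- hypothesis (ii): `∂D'` is smooth real-analytic of finite type near `closure M'`
    (hΩ' : IsOpen Ω') (hM'Ω' : closure M' ⊆ Ω')
    (hr' : AnalyticOnNhd ℝ r' Ω') (hr'grad : ∀ p ∈ Ω', fderiv ℝ r' p ≠ 0)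
    (hr'bd : frontier D' ∩ Ω' = {p : C2 | p ∈ Ω' ∧ r' p = 0})
    (hr'D : D' ∩ Ω' = {p : C2 | p ∈ Ω' ∧ r' p < 0})
    (hft' : ∀ φ : ℂ → C2, DifferentiableOn ℂ φ (Metric.ball (0 : ℂ) 1) →
      (∀ ζ ∈ Metric.ball (0 : ℂ) 1, φ ζ ∈ frontier D' ∩ Ω') →
      ∀ a ∈ Metric.ball (0 : ℂ) 1, ∀ b ∈ Metric.ball (0 : ℂ) 1, φ a = φ b)
    -- hypothesis (iii): the cluster set of `M` under `f` is contained in `M'`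
    (hcl : ∀ p ∈ M, ∀ z : ℕ → C2, (∀ j, z j ∈ D) → Filter.Tendsto z Filter.atTop (nhds p) →
      ∀ w' : C2, Filter.Tendsto (fun j => f (z j)) Filter.atTop (nhds w') → w' ∈ M')
    (p₀ : C2) (γ : Set C2) (hp₀M : p₀ ∈ M) (hγM : γ ⊆ M) (hp₀γ : p₀ ∈ γ)
    -- `γ` is a real-analytic arc: image of an injective real-analytic map with
    -- nowhere-vanishing derivative, relatively closed in `M`
    (hγarc : ∃ (a b : ℝ) (c : ℝ → C2), a < b ∧ AnalyticOnNhd ℝ c (Set.Ioo a b) ∧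
      Set.InjOn c (Set.Ioo a b) ∧ (∀ t ∈ Set.Ioo a b, deriv c t ≠ 0) ∧
      γ = c '' Set.Ioo a b)
    (hγclosed : ∃ Cc : Set C2, IsClosed Cc ∧ γ = M ∩ Cc)
    -- `f` extends holomorphically across every point of `M \\ γ`
    (hext : ∀ q ∈ M \ γ, ∃ W : Set C2, IsOpen W ∧ q ∈ W ∧
      ∃ F : C2 → C2, DifferentiableOn ℂ F W ∧ ∀ z ∈ W ∩ D, F z = f z)
    -- `w' ∈ M'` is a cluster value of `f` at `p₀`
    (w' : C2) (hw' : w' ∈ M')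
    (z : ℕ → C2) (hz : ∀ j, z j ∈ D) (hzp : Filter.Tendsto z Filter.atTop (nhds p₀))
    (hfz : Filter.Tendsto (fun j => f (z j)) Filter.atTop (nhds w')) :
    ∃ (w : ℕ → C2) (v : ℕ → C2),
      (∀ j, w j ∈ M \ γ) ∧ Filter.Tendsto w Filter.atTop (nhds p₀) ∧
      Filter.Tendsto v Filter.atTop (nhds w') ∧
      ∀ j, ∃ (W : Set C2) (F : C2 → C2), IsOpen W ∧ w j ∈ W ∧
        DifferentiableOn ℂ F W ∧ (∀ ζ ∈ W ∩ D, F ζ = f ζ) ∧ F (w j) = v j := by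
  by_contra hcon
  have hε : ∃ ε > 0, ∀ q ∈ M \ γ, dist q p₀ < ε → ∀ (W : Set C2) (F : C2 → C2), IsOpen W →
      q ∈ W → DifferentiableOn ℂ F W → (∀ ζ ∈ W ∩ D, F ζ = f ζ) → ε ≤ dist (F q) w' := by
    by_contra hne
    push Not at hne
    have hpos : ∀ n : ℕ, (0 : ℝ) < 1 / ((n : ℝ) + 1) := fun n => by positivity
    choose w hw hwd W F hW hwW hF hFf hFw using fun n : ℕ => hne (1 / ((n : ℝ) + 1)) (hpos n)
    apply hcon
    refine ⟨w, fun n => F n (w n), hw, ?_, ?_, fun n =>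
      ⟨W n, F n, hW n, hwW n, hF n, hFf n, rfl⟩⟩
    · rw [tendsto_iff_dist_tendsto_zero]
      exact squeeze_zero (fun _ => dist_nonneg) (fun n => (hwd n).le)
        tendsto_one_div_add_atTop_nhds_zero_nat
    · rw [tendsto_iff_dist_tendsto_zero]
      exact squeeze_zero (fun _ => dist_nonneg) (fun n => (hFw n).le)
        tendsto_one_div_add_atTop_nhds_zero_nat
  obtain ⟨ε, hεp, hε⟩ := hε
  have hpΩ : p₀ ∈ Ω := hMΩ (subset_closure hp₀M)
  have hwΩ : w' ∈ Ω' := hM'Ω' (subset_closure hw')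
  have hr0 : r p₀ = 0 := by
    have h : p₀ ∈ frontier D ∩ Ω := ⟨hMsub hp₀M, hpΩ⟩
    rw [hrbd] at h
    exact h.2
  obtain ⟨O, hO, hMO⟩ := hMopen
  have hpO : p₀ ∈ O := by
    have h := hp₀M
    rw [hMO] at h
    exact h.2
  obtain ⟨a, b, c, hab, hc, -, -, hγc⟩ := hγarc
  have hNP : NoPeak (ball w' ε ∩ clus D f p₀) := by
    refine noPeak_main D f r p₀ w' γ ε hD hf (hr p₀ hpΩ) hr0 (hrgrad p₀ hpΩ) ?_ ?_ ?_
    · filter_upwards [hΩ.mem_nhds hpΩ] with x hx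
      have h : x ∈ D ∩ Ω ↔ x ∈ {p : C2 | p ∈ Ω ∧ r p < 0} := by rw [hrD]
      exact ⟨fun hxD => (h.1 ⟨hxD, hx⟩).2, fun hxr => (h.2 ⟨hx, hxr⟩).1⟩
    · intro v hv O' hO' hne
      rw [hγc]
      exact arc_avoid c a b hc v hv O' hO' hne
    · filter_upwards [hO.mem_nhds hpO, ball_mem_nhds p₀ hεp] with x hxO hxb hxf hxγ
      have hxM : x ∈ M \ γ := ⟨by rw [hMO]; exact ⟨hxf, hxO⟩, hxγ⟩
      obtain ⟨W, hW, hxW, F, hF, hFf⟩ := hext x hxM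
      exact ⟨W, F, hW, hxW, hF, hFf, hε x hxM hxb W F hW hxW hF hFf⟩
  have hwS : w' ∈ ball w' ε ∩ clus D f p₀ := ⟨mem_ball_self hεp, z, hz, hzp, hfz⟩
  obtain ⟨φ, hφ, hφr, a', ha', b', hb', hne⟩ := disc_final hNP hwS r' (hr' w' hwΩ)
    (Eventually.of_forall fun w hw => by
      obtain ⟨-, z', hz', hz'p, hz'f⟩ := hw
      have hwM := hcl p₀ hp₀M z' hz' hz'p w hz'f
      have h : w ∈ frontier D' ∩ Ω' := ⟨hM'sub hwM, hM'Ω' (subset_closure hwM)⟩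
      rw [hr'bd] at h
      exact h.2) (hr'grad w' hwΩ) Ω' (hΩ'.mem_nhds hwΩ)
  refine hne (hft' φ hφ (fun ζ hζ => ?_) a' ha' b' hb')
  rw [hr'bd]
  exact ⟨(hφr ζ hζ).2, (hφr ζ hζ).1⟩
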